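/- arXiv:math/0611547 — 4 statements merged into one kernel-verified Lean document; each statement's English description precedes it below -/
import Mathlib

section
/- For every complex character χ of G one has ⟨χ|_{H₃}, θ₃⟩ = ⟨χ|_{H₃}, θ₃²⟩, and ⟨χ|_{H₇}, θ₇^k⟩ = ⟨χ|_{H₇}, θ₇^{7−k}⟩ for each k ∈ {1,…,6}; equivalently, the induced characters satisfy Ind_{H₃}^G θ₃ = Ind_{H₃}^G θ₃² and Ind_{H₇}^G θ₇^k = Ind_{H₇}^G θ₇^{−k}. -/
open scoped BigOperators Classical

noncomputable section

/-- The projective special linear group `PSL(2, F) = SL(2, F)/{±I}` (for `F` a finite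
field of odd characteristic the center of `SL(2,F)` is exactly `{±I}`). -/
abbrev PSL2 (F : Type) [Field F] : Type :=
  Matrix.SpecialLinearGroup (Fin 2) F ⧸ Subgroup.center (Matrix.SpecialLinearGroup (Fin 2) F)

/-- `χ` is the character of some finite-dimensional complex representation of `G`. -/
def IsCharacter (G : Type) [Group G] (χ : G → ℂ) : Prop :=
  ∃ V : FDRep ℂ G, V.character = χ

/-- `χ` is an irreducible complex character of `G`. -/
def IsIrrCharacter (G : Type) [Group G] (χ : G → ℂ) : Prop :=
  ∃ V : FDRep ℂ G, CategoryTheory.Simple V ∧ V.character = χ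

/-- `⟨χ|_H, θ⟩ = (1/|H|) ∑_{h ∈ H} χ(h) θ(h)⁻¹`, the multiplicity of the linear
character `θ` of `H` in the restriction `χ|_H`. -/
def restMult {G : Type} [Group G] [Finite G] (H : Subgroup G) (θ : H →* ℂˣ) (χ : G → ℂ) : ℂ :=
  letI : Fintype H := Fintype.ofFinite H
  (Nat.card H : ℂ)⁻¹ * ∑ h : H, χ h * ((θ h : ℂ))⁻¹

/-- `dim χ^H = (1/|H|) ∑_{h ∈ H} χ(h)`, the dimension of the `H`-fixed subspace. -/
def dimFixed {G : Type} [Group G] [Finite G] (H : Subgroup G) (χ : G → ℂ) : ℂ :=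
  letI : Fintype H := Fintype.ofFinite H
  (Nat.card H : ℂ)⁻¹ * ∑ h : H, χ h

/-- The ramification multiplicity
`Γ(χ) = (1/2)⟨χ|_{H₂},θ₂⟩ + (1/3)(⟨χ|_{H₃},θ₃⟩ + 2⟨χ|_{H₃},θ₃²⟩)
  + (1/7)∑_{k=1}^{6} k ⟨χ|_{H₇},θ₇^k⟩`. -/
def ramMult {G : Type} [Group G] [Finite G] (H2 H3 H7 : Subgroup G)
    (θ2 : H2 →* ℂˣ) (θ3 : H3 →* ℂˣ) (θ7 : H7 →* ℂˣ) (χ : G → ℂ) : ℂ :=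
  (1/2) * restMult H2 θ2 χ
    + (1/3) * (restMult H3 θ3 χ + 2 * restMult H3 (θ3 ^ 2) χ)
    + (1/7) * ∑ k ∈ Finset.Icc (1:ℕ) 6, (k : ℂ) * restMult H7 (θ7 ^ k) χ

/-- The base multiplicity `m = (q−ε₂)/4 + (q−ε₃)/3 + 3(q−ε₇)/7`, where
`ε_ℓ = 1` if `q ≡ 1 (mod ℓ')` and `ε_ℓ = −1` otherwise. -/
def baseMult (q : ℕ) : ℤ :=
  ((q : ℤ) - (if q % 4 = 1 then 1 else -1)) / 4
    + ((q : ℤ) - (if q % 3 = 1 then 1 else -1)) / 3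
    + 3 * (((q : ℤ) - (if q % 7 = 1 then 1 else -1)) / 7)

end

/-- The quadric `x² + yz = -1` meets the plane `(a - d) x + c y + b z = 0` over a finite field of
odd order, provided the normal vector of the plane is not isotropic. -/
theorem exists_sq_add_mul_eq_neg_one_of_linear {F : Type*} [Field F] [Fintype F]
    (hF : Fintype.card F % 2 = 1) (e b c : F) (hD : e ^ 2 + 4 * b * c ≠ 0) :
    ∃ x y z : F, x ^ 2 + y * z = -1 ∧ e * x + c * y + b * z = 0 := by
  have h2 : (2 : F) ≠ 0 := Ring.two_ne_zero fun h =>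
    by simpa [hF] using FiniteField.even_card_iff_char_two.mp h
  by_cases hc : c = 0
  · subst hc
    have he : e ≠ 0 := by rintro rfl; simp at hD
    by_cases hb : b = 0
    · exact ⟨0, 1, -1, by simp, by simp [hb]⟩
    · exact ⟨1, 2 * b / e, -e / b, by field_simp; norm_num, by field_simp; ring⟩
  · obtain ⟨X, z, h⟩ := FiniteField.exists_root_sum_quadratic
      (f := Polynomial.C 1 * Polynomial.X ^ 2 + Polynomial.C 0 * Polynomial.X
        + Polynomial.C (4 * c ^ 2))
      (g := Polynomial.C (-(e ^ 2 + 4 * b * c)) * Polynomial.X ^ 2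
        + Polynomial.C 0 * Polynomial.X + Polynomial.C 0)
      (Polynomial.degree_quadratic one_ne_zero)
      (Polynomial.degree_quadratic (neg_ne_zero.mpr hD)) hF
    simp only [Polynomial.eval_add, Polynomial.eval_mul, Polynomial.eval_C, Polynomial.eval_pow,
      Polynomial.eval_X] at h
    have h4 : (4 : F) ≠ 0 := by
      have : (4 : F) = 2 * 2 := by norm_num
      rw [this]; exact mul_ne_zero h2 h2
    refine ⟨(X + e * z) / (2 * c), -(e * ((X + e * z) / (2 * c)) + b * z) / c, z, ?_, ?_⟩
    · field_simp
      linear_combination h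
    · field_simp
      ring

/-- An element of `SL(2, F)` with distinct eigenvalues is conjugate to its inverse. -/
theorem isConj_inv_of_discr_ne_zero {F : Type*} [Field F] [Fintype F]
    (hF : Fintype.card F % 2 = 1) (A : Matrix.SpecialLinearGroup (Fin 2) F)
    (hD : (A 0 0 - A 1 1) ^ 2 + 4 * A 0 1 * A 1 0 ≠ 0) : IsConj A A⁻¹ := by
  obtain ⟨x, y, z, hdet, hlin⟩ := exists_sq_add_mul_eq_neg_one_of_linear hF _ _ _ hD
  let B : Matrix.SpecialLinearGroup (Fin 2) F :=
    ⟨!![x, y; z, -x], by rw [Matrix.det_fin_two_of]; linear_combination -hdet⟩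
  refine isConj_iff.mpr ⟨B, mul_inv_eq_iff_eq_mul.mpr ?_⟩
  ext i j
  rw [Matrix.SpecialLinearGroup.coe_mul, Matrix.SpecialLinearGroup.coe_mul,
    Matrix.SpecialLinearGroup.coe_inv, Matrix.adjugate_fin_two]
  fin_cases i <;> fin_cases j <;> simp [B, Matrix.mul_apply, Fin.sum_univ_two]
  · linear_combination hlin
  · ring
  · ring
  · linear_combination hlin

/-- If the characteristic polynomial of `A ∈ SL(2, F)` has a double root, then `A ^ |F|` is
central. -/
theorem pow_card_mem_center_of_discr_eq_zero {F : Type*} [Field F] [Fintype F]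
    (hF : Fintype.card F % 2 = 1) (A : Matrix.SpecialLinearGroup (Fin 2) F)
    (hD : (A 0 0 - A 1 1) ^ 2 + 4 * A 0 1 * A 1 0 = 0) :
    A ^ Fintype.card F ∈ Subgroup.center (Matrix.SpecialLinearGroup (Fin 2) F) := by
  have h2 : (2 : F) ≠ 0 := Ring.two_ne_zero fun h =>
    by simpa [hF] using FiniteField.even_card_iff_char_two.mp h
  set s : F := (A 0 0 + A 1 1) / 2 with hs
  set N : Matrix (Fin 2) (Fin 2) F := (A : Matrix (Fin 2) (Fin 2) F) - Matrix.scalar (Fin 2) s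
    with hN
  have hN2 : N ^ 2 = 0 := by
    ext i j
    rw [pow_two, hN]
    fin_cases i <;> fin_cases j <;>
      simp [Matrix.mul_apply, Fin.sum_univ_two, Matrix.sub_apply, hs] <;> field_simp
    · linear_combination hD
    · ring
    · ring
    · linear_combination hD
  obtain ⟨p, hp⟩ := CharP.exists F
  obtain ⟨n, hprime, hcard⟩ := FiniteField.card F p
  have := Fact.mk hprime
  have hpow : (A : Matrix (Fin 2) (Fin 2) F) ^ Fintype.card F
      = Matrix.scalar (Fin 2) (s ^ Fintype.card F) := by
    have hA : (A : Matrix (Fin 2) (Fin 2) F) = Matrix.scalar (Fin 2) s + N := by simp [hN]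
    have hcomm : Commute (Matrix.scalar (Fin 2) s) N := Matrix.scalar_commute s (Commute.all s) N
    have hle : 2 ≤ Fintype.card F := Fintype.one_lt_card
    rw [hA, hcard, add_pow_char_pow_of_commute _ _ hcomm, ← hcard,
      pow_eq_zero_of_le hle hN2, add_zero, map_pow]
  rw [Matrix.SpecialLinearGroup.mem_center_iff]
  refine ⟨s ^ Fintype.card F, ?_, by rw [Matrix.SpecialLinearGroup.coe_pow, hpow]⟩
  have hdet := congrArg Matrix.det hpow
  rwa [Matrix.det_pow, A.det_coe, one_pow, Matrix.scalar_apply, Matrix.det_diagonal,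
    Finset.prod_const, Finset.card_univ, eq_comm] at hdet

/-- For odd `|F|`, an element of `PSL(2, F)` of order coprime to `|F|` is conjugate to its
inverse. -/
theorem PSL2.isConj_inv_of_coprime_orderOf {F : Type} [Field F] [Fintype F]
    (hF : Fintype.card F % 2 = 1) (g : PSL2 F)
    (hg : (orderOf g).Coprime (Fintype.card F)) : IsConj g g⁻¹ := by
  obtain ⟨A, rfl⟩ := QuotientGroup.mk_surjective g
  by_cases hD : (A 0 0 - A 1 1) ^ 2 + 4 * A 0 1 * A 1 0 = 0
  · have hpow : (A : PSL2 F) ^ Fintype.card F = 1 := by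
      rw [← QuotientGroup.mk_pow, QuotientGroup.eq_one_iff]
      exact pow_card_mem_center_of_discr_eq_zero hF A hD
    have hone : (A : PSL2 F) = 1 :=
      orderOf_eq_one_iff.mp (hg.eq_one_of_dvd (orderOf_dvd_of_pow_eq_one hpow))
    rw [hone, inv_one]
  · exact (QuotientGroup.mk' (Subgroup.center (Matrix.SpecialLinearGroup (Fin 2) F))).map_isConj
      (isConj_inv_of_discr_ne_zero hF A hD)

theorem IsCharacter.eq_of_isConj {G : Type} [Group G] {χ : G → ℂ} (hχ : IsCharacter G χ)
    {g h : G} (hgh : IsConj g h) : χ g = χ h := by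
  obtain ⟨V, rfl⟩ := hχ
  obtain ⟨c, rfl⟩ := isConj_iff.mp hgh
  exact (V.char_conj g c).symm

theorem restMult_inv {G : Type} [Group G] [Finite G] (H : Subgroup G) (θ : H →* ℂˣ) (χ : G → ℂ)
    (hχ : ∀ h ∈ H, χ h = χ h⁻¹) : restMult H θ⁻¹ χ = restMult H θ χ := by
  unfold restMult
  let _ : Fintype H := Fintype.ofFinite H
  congr 1
  refine Fintype.sum_equiv (Equiv.inv H) _ _ fun h => ?_
  simp [hχ h h.2]

/-- Each `ψ : H → ℂˣ` has the same multiplicity as `ψ⁻¹` in the restriction to `H` of a character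
of `PSL(2, F)`, if `|H|` is coprime to the odd number `|F|`. -/
theorem PSL2.restMult_inv_of_coprime {F : Type} [Field F] [Fintype F]
    (hF : Fintype.card F % 2 = 1) (H : Subgroup (PSL2 F))
    (hH : (Nat.card H).Coprime (Fintype.card F)) (ψ : H →* ℂˣ) {χ : PSL2 F → ℂ}
    (hχ : IsCharacter (PSL2 F) χ) : restMult H ψ⁻¹ χ = restMult H ψ χ :=
  restMult_inv H ψ χ fun h hh => hχ.eq_of_isConj <|
    PSL2.isConj_inv_of_coprime_orderOf hF h <|
      hH.coprime_dvd_left (Subgroup.orderOf_dvd_natCard H hh)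

theorem induced_characters_coincide
    (q : ℕ) (hq : IsPrimePow q) (hgcd : Nat.Coprime q 42)
    (hq7 : q % 7 = 1 ∨ q % 7 = 6)
    (F : Type) [Field F] [Fintype F] (hF : Fintype.card F = q)
    (H2 H3 H7 : Subgroup (PSL2 F))
    (hH2 : Nat.card H2 = 2) (hH3 : Nat.card H3 = 3) (hH7 : Nat.card H7 = 7)
    (θ2 : H2 →* ℂˣ) (θ3 : H3 →* ℂˣ) (θ7 : H7 →* ℂˣ)
    (hθ2 : Function.Injective θ2) (hθ3 : Function.Injective θ3)
    (hθ7 : Function.Injective θ7)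
    (χ : PSL2 F → ℂ) (hχ : IsCharacter (PSL2 F) χ)
    :
    restMult H3 θ3 χ = restMult H3 (θ3 ^ 2) χ ∧
    ∀ k ∈ Finset.Icc (1:ℕ) 6, restMult H7 (θ7 ^ k) χ = restMult H7 (θ7 ^ (-(k : ℤ))) χ := by
  subst hF
  have hodd : Fintype.card F % 2 = 1 :=
    Nat.odd_iff.mp (Nat.coprime_two_right.mp (hgcd.coprime_dvd_right (by norm_num)))
  refine ⟨?_, fun k _ => ?_⟩
  · have hcop : (Nat.card H3).Coprime (Fintype.card F) :=
      (hgcd.coprime_dvd_right (by rw [hH3]; norm_num)).symm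
    have hsq : θ3 ^ 2 = θ3⁻¹ := by
      ext h
      have h3 : h ^ 3 = 1 := by rw [← hH3]; exact pow_card_eq_one'
      have hval : θ3 h ^ 2 = (θ3 h)⁻¹ := by
        rw [eq_inv_iff_mul_eq_one, ← pow_succ, ← map_pow, h3, map_one]
      rw [MonoidHom.pow_apply, MonoidHom.inv_apply, hval]
    rw [hsq, PSL2.restMult_inv_of_coprime hodd H3 hcop θ3 hχ]
  · have hcop : (Nat.card H7).Coprime (Fintype.card F) :=
      (hgcd.coprime_dvd_right (by rw [hH7]; norm_num)).symm
    have hneg : θ7 ^ (-(k : ℤ)) = (θ7 ^ k)⁻¹ :=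
      (zpow_neg θ7 k).trans (congrArg _ (zpow_natCast θ7 k))
    rw [hneg, PSL2.restMult_inv_of_coprime hodd H7 hcop (θ7 ^ k) hχ]
end

section
/- Let r₂, r₃, r₇ be natural numbers with r₇ ≡ 0, 3, or 6 (mod 7). Then for every automorphism σ of the field ℂ and every irreducible complex character χ of G, Σ_{k=1}^{r₂} ⟨χ|_{H₂}, θ₂^{−k}⟩ + Σ_{k=1}^{r₃} ⟨χ|_{H₃}, θ₃^{−k}⟩ + Σ_{k=1}^{r₇} ⟨χ|_{H₇}, θ₇^{−k}⟩ = Σ_{k=1}^{r₂} ⟨(σ∘χ)|_{H₂}, θ₂^{−k}⟩ + Σ_{k=1}^{r₃} ⟨(σ∘χ)|_{H₃}, θ₃^{−k}⟩ + Σ_{k=1}^{r₇} ⟨(σ∘χ)|_{H₇}, θ₇^{−k}⟩; that is, the equivariant degree of the invariant divisor r₁D₁ + r₂D₂ + r₃D₃ + r₇D₇ is Galois-invariant whenever r₇ ≡ 0, 3, or 6 (mod 7). -/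
open scoped BigOperators Classical

section RestrictionMultiplicity

variable {G : Type} [Group G]

theorem map_pow_natCard_eq_one {H : Subgroup G} {θ : H →* ℂˣ} (h : H) :
    (θ h : ℂ) ^ Nat.card H = 1 := by
  rw [← Units.val_pow_eq_pow_val, ← map_pow, pow_card_eq_one', map_one, Units.val_one]

variable [Finite G] (H : Subgroup G) (θ : H →* ℂˣ)

theorem restMult_sub (χ ψ : G → ℂ) :
    restMult H θ (χ - ψ) = restMult H θ χ - restMult H θ ψ := by
  simp only [restMult, Pi.sub_apply, sub_mul, Finset.sum_sub_distrib, mul_sub]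

theorem restMult_zpow_neg (χ : G → ℂ) (k : ℕ) :
    letI : Fintype H := Fintype.ofFinite H
    restMult H (θ ^ (-(k : ℤ))) χ = (Nat.card H : ℂ)⁻¹ * ∑ h : H, χ h * (θ h : ℂ) ^ k := by
  simp [restMult]

variable {H θ}

theorem restMult_zpow_neg_add_natCard (χ : G → ℂ) (k : ℕ) :
    restMult H (θ ^ (-((k + Nat.card H : ℕ) : ℤ))) χ = restMult H (θ ^ (-(k : ℤ))) χ := by
  simp only [restMult_zpow_neg, pow_add, map_pow_natCard_eq_one, mul_one]

theorem restMult_zpow_neg_eq_of_add_eq {ψ : G → ℂ} (hψ : ∀ h : H, ψ (h : G)⁻¹ = ψ h)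
    {j k : ℕ} (hjk : j + k = Nat.card H) :
    restMult H (θ ^ (-(j : ℤ))) ψ = restMult H (θ ^ (-(k : ℤ))) ψ := by
  let : Fintype H := Fintype.ofFinite H
  simp only [restMult_zpow_neg]
  congr 1
  refine Fintype.sum_equiv (Equiv.inv H) _ _ fun h => ?_
  have h1 : (θ h : ℂ) ^ j * (θ h : ℂ) ^ k = 1 := by
    rw [← pow_add, hjk, map_pow_natCard_eq_one]
  simp only [Equiv.inv_apply, InvMemClass.coe_inv, hψ, map_inv, Units.val_inv_eq_inv_val, inv_pow]
  rw [eq_inv_of_mul_eq_one_left h1]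

theorem sum_restMult_zpow_neg_natCard_eq_zero (hθ : Function.Injective θ) {ψ : G → ℂ}
    (h1 : ψ 1 = 0) :
    ∑ k ∈ Finset.Icc 1 (Nat.card H), restMult H (θ ^ (-(k : ℤ))) ψ = 0 := by
  simp only [restMult_zpow_neg]
  rw [← Finset.mul_sum, Finset.sum_comm]
  refine mul_eq_zero_of_right _ (Finset.sum_eq_zero fun h _ => ?_)
  rw [← Finset.mul_sum]
  by_cases hh : h = 1
  · simp [hh, h1]
  · have hne : (θ h : ℂ) ≠ 1 := fun e => hh (hθ (by rw [map_one]; exact Units.ext e))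
    rw [← Finset.Ico_add_one_right_eq_Icc, geom_sum_Ico hne (by simp), pow_succ,
      map_pow_natCard_eq_one]
    simp

theorem sum_restMult_zpow_neg_mod (hθ : Function.Injective θ) {ψ : G → ℂ} (h1 : ψ 1 = 0)
    (r : ℕ) :
    ∑ k ∈ Finset.Icc 1 (r % Nat.card H), restMult H (θ ^ (-(k : ℤ))) ψ =
      ∑ k ∈ Finset.Icc 1 r, restMult H (θ ^ (-(k : ℤ))) ψ := by
  have hp : Function.Periodic
      (fun r : ℕ => ∑ k ∈ Finset.Icc 1 r, restMult H (θ ^ (-(k : ℤ))) ψ) (Nat.card H) := by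
    intro n
    induction n with
    | zero => simpa using sum_restMult_zpow_neg_natCard_eq_zero hθ h1
    | succ n ih =>
      simp only [] at ih ⊢
      rw [add_right_comm, Finset.sum_Icc_succ_top (by omega), ih,
        Finset.sum_Icc_succ_top (by omega), add_right_comm, restMult_zpow_neg_add_natCard]
  exact hp.map_mod_nat r

/-- A class function vanishing at `1`, invariant under inversion on `H` and of mean zero on `H`
contributes nothing to the degree at an orbit with stabilizer `H`. -/
theorem sum_restMult_zpow_neg_eq_zero (hθ : Function.Injective θ) {ψ : G → ℂ} (h1 : ψ 1 = 0)
    (hψ : ∀ h : H, ψ (h : G)⁻¹ = ψ h) (h0 : dimFixed H ψ = 0) (r : ℕ)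
    (hr : Nat.card H = 2 ∨ Nat.card H = 3 ∨
      Nat.card H = 7 ∧ (r % 7 = 0 ∨ r % 7 = 3 ∨ r % 7 = 6)) :
    ∑ k ∈ Finset.Icc 1 r, restMult H (θ ^ (-(k : ℤ))) ψ = 0 := by
  rw [← sum_restMult_zpow_neg_mod hθ h1]
  have htot := sum_restMult_zpow_neg_natCard_eq_zero hθ h1
  have hev := fun j k => restMult_zpow_neg_eq_of_add_eq (θ := θ) hψ (j := j) (k := k)
  have hzero : restMult H (θ ^ (-(Nat.card H : ℤ))) ψ = 0 := by
    rw [restMult_zpow_neg]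
    simp only [map_pow_natCard_eq_one, mul_one]
    exact h0
  obtain ⟨g, hg⟩ : ∃ g : ℕ → ℂ, ∀ k : ℕ, restMult H (θ ^ (-(k : ℤ))) ψ = g k := ⟨_, fun _ => rfl⟩
  simp only [hg] at htot hev hzero ⊢
  rcases hr with hH | hH | ⟨hH, hr⟩ <;> rw [hH] at htot hzero ⊢
  · simp only [Nat.reduceLeDiff, Finset.sum_Icc_succ_top, Finset.Icc_self,
      Finset.sum_singleton] at htot
    have h1 : g 1 = 0 := by linear_combination htot - hzero
    have := Nat.mod_lt r two_pos
    interval_cases r % 2 <;> simp [h1]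
  · have h12 := hev 1 2 hH.symm
    simp only [Nat.reduceLeDiff, Finset.sum_Icc_succ_top, Finset.Icc_self,
      Finset.sum_singleton] at htot
    have h1 : g 1 = 0 := by linear_combination (htot - hzero + h12) / 2
    have := Nat.mod_lt r three_pos
    interval_cases r % 3 <;> simp [Finset.sum_Icc_succ_top, ← h12, h1]
  · have h16 := hev 1 6 hH.symm
    have h25 := hev 2 5 hH.symm
    have h34 := hev 3 4 hH.symm
    rcases hr with hr | hr | hr <;> rw [hr] <;>
      simp [Finset.sum_Icc_succ_top] at htot ⊢
    · linear_combination (htot - hzero + h16 + h25 + h34) / 2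
    · linear_combination htot - hzero

end RestrictionMultiplicity

theorem dimFixed_map_character {G : Type} [Group G] [Finite G] (H : Subgroup G) (V : FDRep ℂ G)
    (σ : ℂ ≃+* ℂ) : dimFixed H (fun g => σ (V.character g)) = dimFixed H V.character := by
  let : Fintype H := Fintype.ofFinite H
  let ρ : Representation ℂ H V := V.ρ.comp H.subtype
  have h := FDRep.average_char_eq_finrank_invariants (FDRep.of ρ)
  have h' : dimFixed H V.character =
      Module.finrank ℂ (Representation.invariants (FDRep.of ρ).ρ) := by
    rw [← h, dimFixed, Nat.card_eq_fintype_card]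
    rfl
  calc dimFixed H (fun g => σ (V.character g)) = σ (dimFixed H V.character) := by
        simp [dimFixed]
    _ = dimFixed H V.character := by rw [h', map_natCast]

section ProjectiveSpecialLinear

variable {F : Type} [Field F]

open Matrix Polynomial

theorem sub_sq_eq_zero_of_trace_eq {A : Matrix (Fin 2) (Fin 2) F} (hA : A.det = 1) {ε : F}
    (hε : ε ^ 2 = 1) (ht : A.trace = 2 * ε) : (A - scalar (Fin 2) ε) ^ 2 = 0 := by
  rw [det_fin_two] at hA
  rw [trace_fin_two] at ht
  ext i j
  fin_cases i <;> fin_cases j <;>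
    simp [sq, Matrix.mul_apply, Fin.sum_univ_two]
  · linear_combination A 0 0 * ht + hε - hA
  · linear_combination A 0 1 * ht
  · linear_combination A 1 0 * ht
  · linear_combination A 1 1 * ht + hε - hA

theorem pow_mem_center_of_trace_sq_eq (p : ℕ) [Fact p.Prime] [CharP F p]
    (A : Matrix.SpecialLinearGroup (Fin 2) F) (hA : A.1.trace ^ 2 = 4) :
    A ^ p ∈ Subgroup.center (Matrix.SpecialLinearGroup (Fin 2) F) := by
  obtain ⟨ε, hε, ht⟩ : ∃ ε : F, ε ^ 2 = 1 ∧ A.1.trace = 2 * ε := by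
    have : A.1.trace ^ 2 = 2 ^ 2 := by rw [hA]; norm_num
    rcases sq_eq_sq_iff_eq_or_eq_neg.mp this with h | h
    · exact ⟨1, by simp, by simpa using h⟩
    · exact ⟨-1, by simp, by simpa using h⟩
  have hN := sub_sq_eq_zero_of_trace_eq A.2 hε ht
  have hp : (A.1 - scalar (Fin 2) ε) ^ p = 0 :=
    pow_eq_zero_of_le (Fact.out : p.Prime).two_le hN
  rw [sub_pow_char_of_commute _ ((scalar_commute ε (Commute.all ε) A.1).symm), sub_eq_zero,
    ← map_pow] at hp
  rw [Matrix.SpecialLinearGroup.mem_center_iff]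
  refine ⟨ε ^ p, ?_, ?_⟩
  · have := congrArg det hp
    rw [← Matrix.SpecialLinearGroup.coe_pow] at hp
    have h := (A ^ p).2
    rw [hp] at h
    simpa using h
  · rw [Matrix.SpecialLinearGroup.coe_pow, hp]

variable [Fintype F]

theorem exists_sq_sub_mul_sq_eq_neg_one (hF : Fintype.card F % 2 = 1) {D : F} (hD : D ≠ 0) :
    ∃ x y : F, x ^ 2 - D * y ^ 2 = -1 := by
  obtain ⟨x, y, h⟩ := FiniteField.exists_root_sum_quadratic
    (f := (X ^ 2 + C 1 : F[X])) (g := C (-D) * X ^ 2) (degree_X_pow_add_C (by norm_num) 1)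
    (degree_C_mul_X_pow 2 (neg_ne_zero.mpr hD)) hF
  refine ⟨x, y, ?_⟩
  simp at h
  linear_combination h

/-- The traceless matrices of determinant one that invert `!![a, b; c, d]` by conjugation. -/
theorem exists_traceless_orthogonal (hF : Fintype.card F % 2 = 1) {a b c d : F}
    (hD : (a - d) ^ 2 + 4 * (b * c) ≠ 0) :
    ∃ x y z : F, -x ^ 2 - y * z = 1 ∧ x * (a - d) + y * c + z * b = 0 := by
  have h2 : (2 : F) ≠ 0 := Ring.two_ne_zero (FiniteField.even_card_iff_char_two.not.mpr (by omega))
  by_cases hb : b = 0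
  · subst hb
    have had : a - d ≠ 0 := by
      intro h
      simp [h] at hD
    by_cases hc : c = 0
    · exact ⟨0, 1, -1, by ring, by simp [hc]⟩
    · exact ⟨1, -(a - d) / c, 2 * c / (a - d), by field_simp; ring, by field_simp; ring⟩
  · have h4 : (4 : F) ≠ 0 := by
      rw [show (4 : F) = 2 * 2 by norm_num]
      exact mul_ne_zero h2 h2
    obtain ⟨u, v, h⟩ := exists_sq_sub_mul_sq_eq_neg_one hF
      (D := ((a - d) ^ 2 + 4 * (b * c)) / (4 * b ^ 2))
      (div_ne_zero hD (mul_ne_zero h4 (pow_ne_zero 2 hb)))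
    refine ⟨u + (a - d) / (2 * b) * v, v, -((u + (a - d) / (2 * b) * v) * (a - d) + v * c) / b,
      ?_, by field_simp; ring⟩
    field_simp at h ⊢
    linear_combination -h

theorem isConj_inv_of_discrim_ne_zero (hF : Fintype.card F % 2 = 1)
    (A : Matrix.SpecialLinearGroup (Fin 2) F)
    (hD : A.1.trace ^ 2 ≠ 4) : IsConj A A⁻¹ := by
  have hdet := A.2
  rw [det_fin_two] at hdet
  rw [trace_fin_two] at hD
  obtain ⟨x, y, z, h1, h0⟩ := exists_traceless_orthogonal hF
    (a := A.1 0 0) (b := A.1 0 1) (c := A.1 1 0) (d := A.1 1 1)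
    fun h => hD (by linear_combination h + 4 * hdet)
  obtain ⟨B, hB⟩ : ∃ B : Matrix.SpecialLinearGroup (Fin 2) F, B.1 = !![x, y; z, -x] :=
    ⟨⟨_, by rw [det_fin_two_of]; linear_combination h1⟩, rfl⟩
  refine isConj_iff.mpr ⟨B, mul_inv_eq_iff_eq_mul.mpr (Subtype.ext ?_)⟩
  rw [Matrix.SpecialLinearGroup.coe_mul, Matrix.SpecialLinearGroup.coe_mul,
    Matrix.SpecialLinearGroup.coe_inv, hB, adjugate_fin_two]
  ext i j
  fin_cases i <;> fin_cases j <;> simp [Matrix.mul_apply, Fin.sum_univ_two]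
  · linear_combination h0
  · ring
  · ring
  · linear_combination h0

theorem PSL2.isConj_inv_of_coprime (hF : Fintype.card F % 2 = 1) {n : ℕ}
    (hn : n.Coprime (Fintype.card F)) {g : PSL2 F} (hg : g ^ n = 1) : IsConj g g⁻¹ := by
  obtain ⟨A, rfl⟩ := QuotientGroup.mk_surjective g
  by_cases hD : A.1.trace ^ 2 = 4
  · obtain ⟨p, hp⟩ := CharP.exists F
    obtain ⟨m, hpp, hm⟩ := FiniteField.card F p
    have := Fact.mk hpp
    have hgp : (A : PSL2 F) ^ p = 1 := by
      rw [← QuotientGroup.mk_pow, QuotientGroup.eq_one_iff]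
      exact pow_mem_center_of_trace_sq_eq p A hD
    have hnp : n.Coprime p := Nat.Coprime.coprime_dvd_right (hm ▸ dvd_pow_self p m.ne_zero) hn
    have h1 : (A : PSL2 F) = 1 := by
      simpa [hnp.gcd_eq_one] using (pow_gcd_eq_one (a := (A : PSL2 F))).mpr ⟨hg, hgp⟩
    rw [h1, inv_one]
  · exact (QuotientGroup.mk' _).map_isConj (isConj_inv_of_discrim_ne_zero hF A hD)

end ProjectiveSpecialLinear


theorem equivariant_degree_galois_invariant
    (q : ℕ) (hq : IsPrimePow q) (hgcd : Nat.Coprime q 42)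
    (hq7 : q % 7 = 1 ∨ q % 7 = 6)
    (F : Type) [Field F] [Fintype F] (hF : Fintype.card F = q)
    (H2 H3 H7 : Subgroup (PSL2 F))
    (hH2 : Nat.card H2 = 2) (hH3 : Nat.card H3 = 3) (hH7 : Nat.card H7 = 7)
    (θ2 : H2 →* ℂˣ) (θ3 : H3 →* ℂˣ) (θ7 : H7 →* ℂˣ)
    (hθ2 : Function.Injective θ2) (hθ3 : Function.Injective θ3)
    (hθ7 : Function.Injective θ7)
    (r2 r3 r7 : ℕ) (hr7 : r7 % 7 = 0 ∨ r7 % 7 = 3 ∨ r7 % 7 = 6)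
    (σ : ℂ ≃+* ℂ) (χ : PSL2 F → ℂ) (hχ : IsIrrCharacter (PSL2 F) χ)
    :
    (∑ k ∈ Finset.Icc 1 r2, restMult H2 (θ2 ^ (-(k : ℤ))) χ)
      + (∑ k ∈ Finset.Icc 1 r3, restMult H3 (θ3 ^ (-(k : ℤ))) χ)
      + (∑ k ∈ Finset.Icc 1 r7, restMult H7 (θ7 ^ (-(k : ℤ))) χ) =
    (∑ k ∈ Finset.Icc 1 r2, restMult H2 (θ2 ^ (-(k : ℤ))) (fun g => σ (χ g)))
      + (∑ k ∈ Finset.Icc 1 r3, restMult H3 (θ3 ^ (-(k : ℤ))) (fun g => σ (χ g)))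
      + (∑ k ∈ Finset.Icc 1 r7, restMult H7 (θ7 ^ (-(k : ℤ))) (fun g => σ (χ g))) := by
  obtain ⟨V, -, rfl⟩ := hχ
  have hcop : ∀ n, n ∣ 42 → n.Coprime (Fintype.card F) := fun n hn =>
    hF ▸ (hgcd.coprime_dvd_right hn).symm
  have hodd : Fintype.card F % 2 = 1 := by
    have := (Nat.coprime_two_left.mp (hcop 2 (by norm_num)))
    exact Nat.odd_iff.mp this
  have key : ∀ (H : Subgroup (PSL2 F)) (θ : H →* ℂˣ), Function.Injective θ → Nat.card H ∣ 42 →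
      ∀ r : ℕ, (Nat.card H = 2 ∨ Nat.card H = 3 ∨
        Nat.card H = 7 ∧ (r % 7 = 0 ∨ r % 7 = 3 ∨ r % 7 = 6)) →
      ∑ k ∈ Finset.Icc 1 r, restMult H (θ ^ (-(k : ℤ))) V.character =
        ∑ k ∈ Finset.Icc 1 r, restMult H (θ ^ (-(k : ℤ))) (fun g => σ (V.character g)) := by
    intro H θ hθ hH r hr
    have hinv : ∀ h : H, V.character (h : PSL2 F)⁻¹ = V.character h := fun h => by
      obtain ⟨c, hc⟩ := isConj_iff.mp <|
        PSL2.isConj_inv_of_coprime hodd (hcop _ hH) (g := (h : PSL2 F)) (by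
          rw [← SubmonoidClass.coe_pow, pow_card_eq_one', OneMemClass.coe_one])
      rw [← hc, FDRep.char_conj]
    rw [← sub_eq_zero, ← Finset.sum_sub_distrib]
    simp only [← restMult_sub]
    refine sum_restMult_zpow_neg_eq_zero hθ (by simp) (fun h => by simp [hinv]) ?_ r hr
    have h := dimFixed_map_character H V σ
    simp only [dimFixed, Pi.sub_apply, Finset.sum_sub_distrib, mul_sub] at h ⊢
    rw [h, sub_self]
  rw [key H2 θ2 hθ2 (by rw [hH2]; norm_num) r2 (.inl hH2),
    key H3 θ3 hθ3 (by rw [hH3]; norm_num) r3 (.inr (.inl hH3)),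
    key H7 θ7 hθ7 (by rw [hH7]; norm_num) r7 (.inr (.inr ⟨hH7, hr7⟩))]
end

section
/- Suppose q ≡ 1 (mod 7). Then for every k ∈ {1,…,6} and every irreducible complex character χ of G: (a) if χ(1) = q−1 or χ(1) = q, then ⟨χ|_{H₇}, θ₇^k⟩ = (q−1)/7; (b) if χ(1) = q+1, then ⟨χ|_{H₇}, θ₇^k⟩ ∈ {(q−1)/7, (q+6)/7}. -/
open scoped BigOperators Classical

open CategoryTheory in
theorem FDRep.eq_top_of_invariant {G : Type} [Group G] (V : FDRep ℂ G) [Simple V]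
    (S : Submodule ℂ V) (hS : S ≠ ⊥) (h : ∀ g, ∀ v ∈ S, V.ρ g v ∈ S) : S = ⊤ := by
  let σ : Representation ℂ G S :=
    { toFun := fun g => (V.ρ g).restrict (h g)
      map_one' := by ext; simp
      map_mul' := fun a b => by ext; simp }
  let f : FDRep.of σ ⟶ V :=
    { hom := FGModuleCat.ofHom S.subtype
      comm := fun g => by ext x; rfl }
  have hmono : Mono f := by
    refine (Action.forget (FGModuleCat ℂ) G).mono_of_mono_map ?_
    refine (forget₂ (FGModuleCat ℂ) (ModuleCat ℂ)).mono_of_mono_map ?_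
    exact (ModuleCat.mono_iff_injective _).2 S.injective_subtype
  have hne : f ≠ 0 := by
    intro h0
    apply hS
    rw [eq_bot_iff]
    intro x hx
    have := congrArg (fun t : FDRep.of σ ⟶ V => t.hom.hom.hom (⟨x, hx⟩ : S)) h0
    exact this
  have := isIso_of_mono_of_nonzero hne
  rw [eq_top_iff]
  intro x _
  obtain ⟨y, hy⟩ := (FDRep.isoToLinearEquiv (asIso f)).surjective x
  rw [← hy]
  exact Subtype.property (p := fun z => z ∈ S) y

/-- The trace of an endomorphism whose range is spanned by independent eigenvectors. -/
theorem LinearMap.trace_eq_sum_of_eigenvectors {K V ι : Type*} [Field K] [AddCommGroup V]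
    [Module K V] [FiniteDimensional K V] [Fintype ι] (f : V →ₗ[K] V) (b : ι → V) (c : ι → K)
    (hb : LinearIndependent K b) (hr : ∀ x, f x ∈ Submodule.span K (Set.range b))
    (hf : ∀ i, f (b i) = c i • b i) : LinearMap.trace K V f = ∑ i, c i := by
  rw [← LinearMap.trace_restrict_eq_of_forall_mem _ f hr,
    LinearMap.trace_eq_matrix_trace K (Module.Basis.span hb), Matrix.trace]
  refine Finset.sum_congr rfl fun i _ => ?_
  have : f.restrict (fun x _ => hr x) (Module.Basis.span hb i) = c i • Module.Basis.span hb i := by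
    ext
    simp [Module.Basis.span_apply, hf]
  rw [Matrix.diag_apply, LinearMap.toMatrix_apply, this, map_smul, Module.Basis.repr_self]
  simp

theorem Module.End.exists_sum_trace_pow {K V : Type*} [Field K] [CharZero K] [AddCommGroup V]
    [Module K V] [FiniteDimensional K V] {n : ℕ} (hn : n ≠ 0) (f : Module.End K V) (hf : f ^ n = 1) :
    ∃ m : ℕ, ∑ i ∈ Finset.range n, LinearMap.trace K V (f ^ i) = n * m := by
  have hK : (n : K) ≠ 0 := Nat.cast_ne_zero.2 hn
  let s : Module.End K V := ∑ i ∈ Finset.range n, f ^ i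
  have hfs : f * s = s := by
    have h := mul_geom_sum f n
    rwa [hf, sub_self, sub_mul, one_mul, sub_eq_zero] at h
  have hpow : ∀ i, f ^ i * s = s := fun i => by
    induction i with
    | zero => simp
    | succ i ih => rw [pow_succ, mul_assoc, hfs, ih]
  have hss : s * s = (n : K) • s := by
    conv_lhs => enter [1]; change ∑ i ∈ Finset.range n, f ^ i
    rw [Finset.sum_mul, Finset.sum_congr rfl fun i _ => hpow i]
    simp [Nat.cast_smul_eq_nsmul]
  have hid : IsIdempotentElem ((n : K)⁻¹ • s) := by
    rw [IsIdempotentElem, smul_mul_smul_comm, hss, smul_smul, mul_assoc, inv_mul_cancel₀ hK, mul_one]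
  refine ⟨Module.finrank K (LinearMap.range ((n : K)⁻¹ • s)), ?_⟩
  have h := (LinearMap.isProj_range_iff_isIdempotentElem _).2 hid |>.trace
  rw [← h, map_smul, smul_eq_mul, mul_inv_cancel_left₀ hK, map_sum]

namespace Matrix.SpecialLinearGroup

variable {F : Type*} [Field F]

/-- The upper unipotent matrix with off-diagonal entry `x`. -/
def upper (x : F) : SpecialLinearGroup (Fin 2) F := ⟨!![1, x; 0, 1], by simp⟩

/-- The diagonal matrix with entries `a`, `a⁻¹`. -/
def torus : Fˣ →* SpecialLinearGroup (Fin 2) F where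
  toFun a := ⟨!![(a : F), 0; 0, (a⁻¹ : Fˣ)], by simp⟩
  map_one' := by ext i j; fin_cases i <;> fin_cases j <;> simp
  map_mul' a b := Subtype.ext <| by
    change _ = !![(a : F), 0; 0, (a⁻¹ : Fˣ)] * !![(b : F), 0; 0, (b⁻¹ : Fˣ)]
    simp [mul_comm]

/-- The Weyl element. -/
def weyl : SpecialLinearGroup (Fin 2) F := ⟨!![0, 1; -1, 0], by simp⟩

theorem coe_upper (x : F) : (upper x).1 = !![1, x; 0, 1] := rfl

theorem coe_torus (a : Fˣ) : (torus a).1 = !![(a : F), 0; 0, (a : F)⁻¹] := by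
  rw [← Units.val_inv_eq_inv_val]
  rfl

theorem coe_weyl : (weyl : SpecialLinearGroup (Fin 2) F).1 = !![0, 1; -1, 0] := rfl

theorem upper_mul (x y : F) : upper x * upper y = upper (x + y) :=
  Subtype.ext <| by simp [coe_upper, coe_mul, add_comm]

theorem upper_zero : upper (0 : F) = 1 :=
  Subtype.ext <| by simp [coe_upper, Matrix.one_fin_two]

theorem upper_inv (x : F) : (upper x)⁻¹ = upper (-x) := by
  rw [inv_eq_iff_mul_eq_one, upper_mul, add_neg_cancel, upper_zero]

theorem torus_mul_upper (a : Fˣ) (x : F) : torus a * upper x = upper (a ^ 2 * x) * torus a :=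
  Subtype.ext <| by
    simp only [coe_mul, coe_upper, coe_torus]
    ext i j
    fin_cases i <;> fin_cases j <;> simp
    field_simp

theorem torus_mul_weyl (a : Fˣ) : torus a * weyl = weyl * torus a⁻¹ :=
  Subtype.ext <| by simp [coe_mul, coe_weyl, coe_torus]

theorem weyl_conj_torus (a : Fˣ) : weyl * torus a * weyl⁻¹ = torus a⁻¹ := by
  rw [mul_inv_eq_iff_eq_mul, torus_mul_weyl, inv_inv]

/-- The Bruhat decomposition of `SL₂`. -/
theorem bruhat (g : SpecialLinearGroup (Fin 2) F) :
    (∃ a x, g = torus a * upper x) ∨ ∃ x a y, g = upper x * weyl * torus a * upper y := by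
  have hdet : g.1 0 0 * g.1 1 1 - g.1 0 1 * g.1 1 0 = 1 := by rw [← Matrix.det_fin_two, g.2]
  by_cases hc : g.1 1 0 = 0
  · rw [hc, mul_zero, sub_zero] at hdet
    have ha : g.1 0 0 ≠ 0 := left_ne_zero_of_mul_eq_one hdet
    refine Or.inl ⟨Units.mk0 _ ha, g.1 0 1 / g.1 0 0, Subtype.ext ?_⟩
    simp only [coe_mul, coe_upper, coe_torus]
    ext i j
    fin_cases i <;> fin_cases j <;> simp [hc]
    · field_simp
    · exact eq_inv_of_mul_eq_one_right hdet
  · refine Or.inr ⟨g.1 0 0 / g.1 1 0, Units.mk0 (-g.1 1 0) (neg_ne_zero.2 hc),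
      g.1 1 1 / g.1 1 0, Subtype.ext ?_⟩
    simp only [coe_mul, coe_upper, coe_torus, coe_weyl]
    ext i j
    fin_cases i <;> fin_cases j <;> simp <;> field_simp
    linear_combination -hdet

theorem upper_conj_torus (a : Fˣ) (y : F) :
    upper y * torus a * (upper y)⁻¹ = torus a * upper (((a⁻¹ : Fˣ) ^ 2 - 1) * y) := by
  rw [torus_mul_upper, upper_inv, mul_assoc, torus_mul_upper, ← mul_assoc, upper_mul]
  congr 2
  have : (a : F) ≠ 0 := a.ne_zero
  push_cast
  field_simp
  ring

end Matrix.SpecialLinearGroup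

namespace Representation

open Matrix.SpecialLinearGroup

variable {F V : Type*} [Field F] [Fintype F] [AddCommGroup V] [Module ℂ V]
  (ρ : Representation ℂ (Matrix.SpecialLinearGroup (Fin 2) F) V)

/-- The averaging operator over the upper unipotent subgroup. -/
noncomputable def unipotentAverage : Module.End ℂ V :=
  (Fintype.card F : ℂ)⁻¹ • ∑ x : F, ρ (upper x)

theorem unipotentAverage_mul_upper (y : F) :
    ρ.unipotentAverage * ρ (upper y) = ρ.unipotentAverage := by
  rw [unipotentAverage, smul_mul_assoc, Finset.sum_mul]
  congr 1
  simp_rw [← map_mul, upper_mul]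
  exact Fintype.sum_equiv (Equiv.addRight y) _ _ fun x => rfl

theorem upper_mul_unipotentAverage (y : F) :
    ρ (upper y) * ρ.unipotentAverage = ρ.unipotentAverage := by
  rw [unipotentAverage, mul_smul_comm, Finset.mul_sum]
  congr 1
  simp_rw [← map_mul, upper_mul]
  exact Fintype.sum_equiv (Equiv.addLeft y) _ _ fun x => rfl

theorem unipotentAverage_apply_of_fixed {v : V} (hv : ∀ x, ρ (upper x) v = v) :
    ρ.unipotentAverage v = v := by
  simp [unipotentAverage, LinearMap.sum_apply, hv, ← Nat.cast_smul_eq_nsmul ℂ, smul_smul]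

theorem torus_mul_unipotentAverage (a : Fˣ) :
    ρ (torus a) * ρ.unipotentAverage = ρ.unipotentAverage * ρ (torus a) := by
  rw [unipotentAverage, mul_smul_comm, smul_mul_assoc, Finset.mul_sum, Finset.sum_mul]
  congr 1
  simp_rw [← map_mul, torus_mul_upper]
  exact Fintype.sum_equiv (Equiv.mulLeft₀ ((a : F) ^ 2) (by simp)) _ _ fun x => rfl

theorem trace_conj_eq {G : Type*} [Group G] (σ : Representation ℂ G V) (g h : G) :
    LinearMap.trace ℂ V (σ (g * h * g⁻¹)) = LinearMap.trace ℂ V (σ h) := by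
  rw [map_mul, LinearMap.trace_mul_comm, ← map_mul]
  group

/-- Every translate of a regular torus element by a unipotent is conjugate to it. -/
theorem trace_torus_mul_unipotentAverage {a : Fˣ} (ha : a ^ 2 ≠ 1) :
    LinearMap.trace ℂ V (ρ (torus a) * ρ.unipotentAverage) =
      LinearMap.trace ℂ V (ρ (torus a)) := by
  have hne : ((a⁻¹ : Fˣ) : F) ^ 2 - 1 ≠ 0 := by
    rw [sub_ne_zero]
    intro h
    apply ha
    have : (a⁻¹) ^ 2 = 1 := Units.ext (by simpa using h)
    simpa using this
  have key : ∀ x : F, LinearMap.trace ℂ V (ρ (torus a * upper x)) =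
      LinearMap.trace ℂ V (ρ (torus a)) := fun x => by
    rw [← trace_conj_eq ρ (upper (((a⁻¹ : Fˣ) ^ 2 - 1 : F)⁻¹ * x)) (torus a), upper_conj_torus,
      mul_inv_cancel_left₀ hne]
  rw [unipotentAverage, mul_smul_comm, map_smul, Finset.mul_sum, map_sum]
  simp_rw [← map_mul, key]
  simp [smul_eq_mul]

/-- A nonzero representation of `SL₂` with unipotent invariants has a Borel eigenvector. -/
theorem exists_borel_eigenvector [FiniteDimensional ℂ V] (h : ρ.unipotentAverage ≠ 0) :
    ∃ (v : V) (χ : Fˣ →* ℂ), v ≠ 0 ∧ (∀ x, ρ (upper x) v = v) ∧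
      ∀ a, ρ (torus a) v = χ a • v := by
  obtain ⟨g, hg⟩ := IsCyclic.exists_generator (α := Fˣ)
  let E := LinearMap.range ρ.unipotentAverage
  have hmap : ∀ x ∈ E, ρ (torus g) x ∈ E := by
    rintro _ ⟨x, rfl⟩
    exact ⟨ρ (torus g) x, (LinearMap.congr_fun (ρ.torus_mul_unipotentAverage g) x).symm⟩
  have : Nontrivial E := by
    rw [Submodule.nontrivial_iff_ne_bot]
    exact fun h0 => h (LinearMap.range_eq_bot.1 h0)
  obtain ⟨c, hc⟩ := Module.End.exists_eigenvalue ((ρ (torus g)).restrict hmap)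
  obtain ⟨v, hv⟩ := hc.exists_hasEigenvector
  have hv0 : (v : V) ≠ 0 := by simpa using hv.2
  have hvg : ρ (torus g) v = c • (v : V) := congrArg Subtype.val hv.apply_eq_smul
  have hall : ∀ a, ∃ t : ℂ, ρ (torus a) v = t • (v : V) := fun a => by
    obtain ⟨n, rfl⟩ := (isOfFinOrder_of_finite g).mem_powers_iff_mem_zpowers.2 (hg a)
    refine ⟨c ^ n, ?_⟩
    simp only
    induction n with
    | zero => simp
    | succ n ih => rw [pow_succ', map_mul, map_mul, Module.End.mul_apply, ih, map_smul, hvg,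
        smul_smul, pow_succ]
  choose t ht using hall
  refine ⟨v, ⟨⟨t, ?_⟩, fun a b => ?_⟩, hv0, fun x => ?_, ht⟩
  · have := ht 1
    rw [map_one, map_one, Module.End.one_apply] at this
    exact smul_left_injective ℂ hv0 (by simpa using this.symm)
  · have := ht (a * b)
    rw [map_mul, map_mul, Module.End.mul_apply, ht b, map_smul, ht a, smul_smul] at this
    exact smul_left_injective ℂ hv0 (by simpa [mul_comm] using this.symm)
  · obtain ⟨y, hy⟩ := v.2
    rw [← hy]
    exact LinearMap.congr_fun (ρ.upper_mul_unipotentAverage x) y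

/-- The torus acts on the unipotent invariants of an irreducible representation of `SL₂`
with trace `0`, `χ` or `χ + χ⁻¹` for a character `χ` of the torus. -/
theorem trace_torus_cases [FiniteDimensional ℂ V]
    (hirr : ∀ S : Submodule ℂ V, S ≠ ⊥ → (∀ g, ∀ v ∈ S, ρ g v ∈ S) → S = ⊤) :
    (∀ a, LinearMap.trace ℂ V (ρ (torus a) * ρ.unipotentAverage) = 0) ∨
    ∃ χ : Fˣ →* ℂ,
      (∀ a, LinearMap.trace ℂ V (ρ (torus a) * ρ.unipotentAverage) = χ a) ∨
      ∀ a, LinearMap.trace ℂ V (ρ (torus a) * ρ.unipotentAverage) = χ a + χ a⁻¹ := by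
  by_cases h : ρ.unipotentAverage = 0
  · simp [h]
  obtain ⟨v, χ, hv0, hu, hd⟩ := ρ.exists_borel_eigenvector h
  refine Or.inr ⟨χ, ?_⟩
  have hev := ρ.unipotentAverage_apply_of_fixed hu
  set e := ρ.unipotentAverage with he
  set v' := e (ρ weyl v) with hv'
  have hev' : e v' = v' := ρ.unipotentAverage_apply_of_fixed fun x =>
    LinearMap.congr_fun (ρ.upper_mul_unipotentAverage x) _
  have hd' : ∀ a, ρ (torus a) v' = χ a⁻¹ • v' := fun a => by
    rw [hv', ← Module.End.mul_apply, torus_mul_unipotentAverage, Module.End.mul_apply,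
      ← Module.End.mul_apply (ρ (torus a)), ← map_mul, torus_mul_weyl, map_mul,
      Module.End.mul_apply, hd, map_smul, map_smul]
  have hspan : Submodule.span ℂ (Set.range fun g => ρ g v) = ⊤ := by
    refine hirr _ ?_ fun g => ?_
    · exact Submodule.ne_bot_iff _ |>.2 ⟨v, Submodule.subset_span ⟨1, by simp⟩, hv0⟩
    · change Submodule.span ℂ _ ≤ (Submodule.span ℂ _).comap (ρ g)
      rw [Submodule.span_le]
      rintro _ ⟨k, rfl⟩
      exact Submodule.subset_span ⟨g * k, by simp⟩
  have hrange : ∀ x, e x ∈ Submodule.span ℂ {v, v'} := by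
    suffices (⊤ : Submodule ℂ V) ≤ (Submodule.span ℂ {v, v'}).comap e from fun x => this Submodule.mem_top
    rw [← hspan, Submodule.span_le]
    rintro _ ⟨g, rfl⟩
    change e (ρ g v) ∈ Submodule.span ℂ {v, v'}
    obtain ⟨a, x, rfl⟩ | ⟨x, a, y, rfl⟩ := bruhat g
    · rw [map_mul, Module.End.mul_apply, hu, hd, map_smul, hev]
      exact Submodule.smul_mem _ _ (Submodule.subset_span (by simp))
    · rw [map_mul, map_mul, map_mul, Module.End.mul_apply, Module.End.mul_apply,
        Module.End.mul_apply, hu, hd, map_smul, map_smul, map_smul, ← Module.End.mul_apply e,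
        unipotentAverage_mul_upper]
      exact Submodule.smul_mem _ _ (Submodule.subset_span (by simp [hv', he]))
  have hcomm : ∀ a x, (ρ (torus a) * e) x = e (ρ (torus a) x) := fun a x =>
    LinearMap.congr_fun (ρ.torus_mul_unipotentAverage a) x
  by_cases hmem : v' ∈ Submodule.span ℂ {v}
  · left
    intro a
    have hle : Submodule.span ℂ {v, v'} ≤ Submodule.span ℂ {v} := by
      rw [Submodule.span_le, Set.insert_subset_iff, Set.singleton_subset_iff]
      exact ⟨Submodule.mem_span_singleton_self v, hmem⟩
    rw [LinearMap.trace_eq_sum_of_eigenvectors _ (fun _ : Unit => v) (fun _ => χ a)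
      (linearIndependent_unique_iff.2 hv0)]
    · simp
    · intro x
      rw [hcomm, Set.range_const]
      exact hle (hrange _)
    · intro _
      rw [hcomm, hd, map_smul, hev]
  · right
    intro a
    rw [LinearMap.trace_eq_sum_of_eigenvectors _ ![v, v'] ![χ a, χ a⁻¹]]
    · simp
    · rw [LinearIndependent.pair_iff' hv0]
      intro c hc
      exact hmem (Submodule.mem_span_singleton.2 ⟨c, hc⟩)
    · intro x
      rw [hcomm]
      rw [Matrix.range_cons_cons_empty]
      exact hrange _
    · intro i
      rw [hcomm]
      fin_cases i
      · simp [hd, hev]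
      · simp [hd', hev']

end Representation

theorem add_one_pow_of_sq_eq_zero {R : Type*} [Ring R] {N : R} (hN : N * N = 0) (n : ℕ) :
    (N + 1) ^ n = n • N + 1 := by
  induction n with
  | zero => simp
  | succ n ih =>
    rw [pow_succ, ih, add_mul, smul_mul_assoc, mul_add, hN, succ_nsmul]
    simp [add_assoc]

namespace Matrix.SpecialLinearGroup

variable {F : Type*} [Field F]

theorem exists_root_of_unity_eigenvalue {A : SpecialLinearGroup (Fin 2) F} {n : ℕ} (hn : 0 < n)
    {ζ : F} (hζ : IsPrimitiveRoot ζ n) (hA : A ^ n = 1) :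
    ∃ μ : F, μ ^ n = 1 ∧ (A.1 - Matrix.scalar (Fin 2) μ).det = 0 := by
  let φ : Polynomial F →* F :=
    Matrix.detMonoidHom.comp (Polynomial.aeval A.1 : Polynomial F →ₐ[F] _).toRingHom.toMonoidHom
  have hφ : φ (Polynomial.X ^ n - 1) = 0 := by
    have hA' : A.1 ^ n = 1 := by rw [← coe_pow, hA]; rfl
    change ((Polynomial.aeval A.1) (Polynomial.X ^ n - 1 : Polynomial F)).det = 0
    simp [hA']
  rw [Polynomial.X_pow_sub_one_eq_prod hn hζ, map_prod, Finset.prod_eq_zero_iff] at hφ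
  obtain ⟨μ, hμ, h⟩ := hφ
  refine ⟨μ, (Polynomial.mem_nthRootsFinset hn 1).1 hμ, ?_⟩
  change ((Polynomial.aeval A.1) (Polynomial.X - Polynomial.C μ : Polynomial F)).det = 0 at h
  rw [map_sub, Polynomial.aeval_X, Polynomial.aeval_C] at h
  exact h

theorem det_sub_scalar (A : SpecialLinearGroup (Fin 2) F) (x : F) :
    (A.1 - Matrix.scalar (Fin 2) x).det = x ^ 2 - (A.1 0 0 + A.1 1 1) * x + 1 := by
  have hdet : A.1 0 0 * A.1 1 1 - A.1 0 1 * A.1 1 0 = 1 := by rw [← Matrix.det_fin_two, A.2]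
  rw [Matrix.det_fin_two]
  simp
  linear_combination hdet

/-- In `SL₂` an element of finite order `n`, invertible in the field, is not unipotent. -/
theorem eq_one_of_eigenvalue_one {A : SpecialLinearGroup (Fin 2) F} {n : ℕ} (hn : (n : F) ≠ 0)
    (hA : A ^ n = 1) (h1 : (A.1 - Matrix.scalar (Fin 2) 1).det = 0) : A = 1 := by
  have hdet : A.1 0 0 * A.1 1 1 - A.1 0 1 * A.1 1 0 = 1 := by rw [← Matrix.det_fin_two, A.2]
  rw [det_sub_scalar] at h1
  have hN : (A.1 - 1) * (A.1 - 1) = 0 := by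
    ext i j
    fin_cases i <;> fin_cases j <;> simp [Matrix.mul_apply, Fin.sum_univ_two]
    · linear_combination -A.1 0 0 * h1 - hdet
    · linear_combination -A.1 0 1 * h1
    · linear_combination -A.1 1 0 * h1
    · linear_combination -A.1 1 1 * h1 - hdet
  have h := add_one_pow_of_sq_eq_zero hN n
  rw [sub_add_cancel, ← coe_pow, hA, coe_one, right_eq_add, ← Nat.cast_smul_eq_nsmul F,
    smul_eq_zero_iff_right hn, sub_eq_zero] at h
  exact Subtype.ext h

/-- If the field contains the `n`-th roots of unity, then elements of odd order `n` of `SL₂`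
are conjugate into the diagonal torus. -/
theorem exists_conj_torus {A : SpecialLinearGroup (Fin 2) F} {n : ℕ} (hodd : Odd n)
    {ζ : F} (hζ : IsPrimitiveRoot ζ n) (hA : A ^ n = 1) (hA1 : A ≠ 1) :
    ∃ P a, A = P * torus a * P⁻¹ ∧ a ^ n = 1 ∧ a ≠ 1 := by
  have hnz : NeZero n := ⟨hodd.pos.ne'⟩
  have hn : (n : F) ≠ 0 := (hζ.neZero').out
  obtain ⟨μ, hμn, hμ⟩ := exists_root_of_unity_eigenvalue hodd.pos hζ hA
  have hμ0 : μ ≠ 0 := by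
    rintro rfl
    rw [zero_pow hodd.pos.ne'] at hμn
    exact zero_ne_one hμn
  have hμ1 : μ ≠ 1 := by
    rintro rfl
    exact hA1 (eq_one_of_eigenvalue_one hn hA hμ)
  have hμ2 : μ ^ 2 ≠ 1 := by
    intro h
    obtain ⟨k, rfl⟩ := hodd
    rw [pow_succ, pow_mul, h, one_pow, one_mul] at hμn
    exact hμ1 hμn
  have hμ' : (A.1 - Matrix.scalar (Fin 2) μ⁻¹).det = 0 := by
    rw [det_sub_scalar] at hμ ⊢
    field_simp
    linear_combination hμ
  obtain ⟨v, hv0, hv⟩ := Matrix.exists_mulVec_eq_zero_iff.2 hμ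
  obtain ⟨w, hw0, hw⟩ := Matrix.exists_mulVec_eq_zero_iff.2 hμ'
  have hv1 := congrFun hv 0
  have hv2 := congrFun hv 1
  have hw1 := congrFun hw 0
  have hw2 := congrFun hw 1
  simp [Matrix.mulVec, dotProduct, Fin.sum_univ_two] at hv1 hv2 hw1 hw2
  have hμμ : μ - μ⁻¹ ≠ 0 := by
    intro h
    apply hμ2
    field_simp at h
    linear_combination h
  have hD : v 0 * w 1 - w 0 * v 1 ≠ 0 := by
    intro h
    have hsing : (!![v 0, w 0; v 1, w 1]).det = 0 := by rw [Matrix.det_fin_two_of, h]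
    obtain ⟨x, hx0, hx⟩ := Matrix.exists_mulVec_eq_zero_iff.2 hsing
    have hx1 := congrFun hx 0
    have hx2 := congrFun hx 1
    simp [Matrix.mulVec, dotProduct, Fin.sum_univ_two] at hx1 hx2
    have e1 : (μ - μ⁻¹) * (x 0 * v 0) = 0 := by
      linear_combination (A.1 0 0 - μ⁻¹) * hx1 + A.1 0 1 * hx2 - x 0 * hv1 - x 1 * hw1
    have e2 : (μ - μ⁻¹) * (x 0 * v 1) = 0 := by
      linear_combination (A.1 1 1 - μ⁻¹) * hx2 + A.1 1 0 * hx1 - x 0 * hv2 - x 1 * hw2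
    have e1' := (mul_eq_zero.1 e1).resolve_left hμμ
    have e2' := (mul_eq_zero.1 e2).resolve_left hμμ
    rw [mul_comm, e1', zero_add] at hx1
    rw [mul_comm, e2', zero_add] at hx2
    have hx00 : x 0 = 0 := by
      by_contra hne
      apply hv0
      ext i
      fin_cases i
      · exact (mul_eq_zero.1 e1').resolve_left hne
      · exact (mul_eq_zero.1 e2').resolve_left hne
    have hx10 : x 1 = 0 := by
      by_contra hne
      apply hw0
      ext i
      fin_cases i
      · exact (mul_eq_zero.1 hx1).resolve_right hne
      · exact (mul_eq_zero.1 hx2).resolve_right hne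
    apply hx0
    ext i
    fin_cases i
    · exact hx00
    · exact hx10
  set D := v 0 * w 1 - w 0 * v 1 with hDdef
  let P : SpecialLinearGroup (Fin 2) F := ⟨!![v 0 / D, w 0; v 1 / D, w 1], by
    rw [Matrix.det_fin_two_of]
    field_simp
    rw [hDdef]⟩
  refine ⟨P, Units.mk0 μ hμ0, ?_, ?_, ?_⟩
  · rw [eq_mul_inv_iff_mul_eq]
    apply Subtype.ext
    rw [coe_mul, coe_mul, coe_torus]
    change A.1 * !![v 0 / D, w 0; v 1 / D, w 1] = !![v 0 / D, w 0; v 1 / D, w 1] * _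
    ext i j
    fin_cases i <;> fin_cases j <;> simp [Matrix.mul_apply, Fin.sum_univ_two]
    · linear_combination hv1 / D
    · linear_combination hw1
    · linear_combination hv2 / D
    · linear_combination hw2
  · ext
    simpa using hμn
  · intro h
    exact hμ1 (congrArg Units.val h)

theorem sq_eq_one_of_mem_center {z : SpecialLinearGroup (Fin 2) F}
    (hz : z ∈ Subgroup.center (SpecialLinearGroup (Fin 2) F)) : z ^ 2 = 1 := by
  obtain ⟨r, hr, hrz⟩ := mem_center_iff.1 hz
  apply Subtype.ext
  rw [coe_pow, ← hrz, ← map_pow, ← Fintype.card_fin 2, hr, map_one]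
  rfl

end Matrix.SpecialLinearGroup

theorem FiniteField.exists_isPrimitiveRoot {F : Type*} [Field F] [Fintype F] {n : ℕ}
    (h : n ∣ Fintype.card F - 1) : ∃ ζ : F, IsPrimitiveRoot ζ n := by
  obtain ⟨g, hg⟩ := IsCyclic.exists_ofOrder_eq_natCard (α := Fˣ)
  rw [Nat.card_eq_fintype_card, Fintype.card_units] at hg
  obtain ⟨m, hm⟩ := h
  have hpos : 0 < Fintype.card F - 1 := Nat.sub_pos_of_lt Fintype.one_lt_card
  refine ⟨(g ^ m : Fˣ), IsPrimitiveRoot.coe_units_iff.2 ?_⟩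
  refine IsPrimitiveRoot.pow hpos (hg ▸ IsPrimitiveRoot.orderOf g) ?_
  rw [hm, mul_comm]

theorem restMult_eq_sum_range {G : Type} [Group G] [Finite G] (H : Subgroup G) (θ : H →* ℂˣ)
    (χ : G → ℂ) (h : H) (hgen : ∀ x, x ∈ Subgroup.zpowers h) :
    restMult H θ χ = (Nat.card H : ℂ)⁻¹ *
      ∑ i ∈ Finset.range (Nat.card H), χ ((h : G) ^ i) * ((θ h : ℂ)⁻¹) ^ i := by
  let := Fintype.ofFinite H
  have hord : orderOf h = Nat.card H := orderOf_eq_card_of_forall_mem_zpowers hgen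
  rw [restMult]
  congr 1
  rw [← IsCyclic.image_range_card hgen, Finset.sum_image]
  · simp
  · rw [← hord]
    intro i hi j hj
    exact pow_injOn_Iio_orderOf (by simpa using hi) (by simpa using hj)

theorem sum_range_pow_eq_ite {K : Type*} [Field K] {n : ℕ} {z : K} (hz : z ^ n = 1) :
    ∑ i ∈ Finset.range n, z ^ i = if z = 1 then (n : K) else 0 := by
  split_ifs with h
  · simp [h]
  · rw [geom_sum_eq h, hz, sub_self, zero_div]

theorem exists_lift_eq_torus_conj {F : Type} [Field F] {n : ℕ} (hodd : Odd n)
    {ζ : F} (hζ : IsPrimitiveRoot ζ n) {g : PSL2 F} (hg : g ^ n = 1) (hg1 : g ≠ 1) :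
    ∃ P a, g = QuotientGroup.mk (P * Matrix.SpecialLinearGroup.torus a * P⁻¹) ∧
      a ^ n = 1 ∧ a ≠ 1 := by
  obtain ⟨A, rfl⟩ := QuotientGroup.mk_surjective g
  have hsq : (A ^ n) ^ 2 = 1 := Matrix.SpecialLinearGroup.sq_eq_one_of_mem_center <| by
    rwa [← QuotientGroup.eq_one_iff, QuotientGroup.mk_pow]
  have hlift : (QuotientGroup.mk (A ^ (n + 1)) : PSL2 F) = QuotientGroup.mk A := by
    rw [QuotientGroup.mk_pow, pow_succ, hg, one_mul]
  obtain ⟨m, hm⟩ : Even (n + 1) := hodd.add_one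
  obtain ⟨P, a, hP, ha⟩ := Matrix.SpecialLinearGroup.exists_conj_torus hodd hζ
    (A := A ^ (n + 1))
    (by rw [← pow_mul, mul_comm, pow_mul, hm, ← two_mul, pow_mul, hsq, one_pow])
    (by
      intro h
      rw [h, QuotientGroup.mk_one] at hlift
      exact hg1 hlift.symm)
  exact ⟨P, a, by rw [← hP, hlift], ha⟩

/-- Pairing the character values on the powers of a torus element `a` of prime order `p` with
the powers of a nontrivial `p`-th root of unity, for an irreducible representation of `SL₂` whose
dimension is congruent to `d ≤ 2` modulo `p`. -/
theorem sum_trace_torus_pow {F V : Type*} [Field F] [Fintype F] [AddCommGroup V] [Module ℂ V]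
    [FiniteDimensional ℂ V] (ρ : Representation ℂ (Matrix.SpecialLinearGroup (Fin 2) F) V)
    (hirr : ∀ S : Submodule ℂ V, S ≠ ⊥ → (∀ g, ∀ v ∈ S, ρ g v ∈ S) → S = ⊤)
    {a : Fˣ} {p d : ℕ} (hp : p.Prime) (hp3 : 3 ≤ p) (ha : a ^ p = 1) (ha1 : a ≠ 1)
    (hd : d ≤ 2) (hdim : Module.finrank ℂ V % p = d) {z : ℂ} (hz : z ^ p = 1) (hz1 : z ≠ 1) :
    (∑ i ∈ Finset.range p,
        LinearMap.trace ℂ V (ρ (Matrix.SpecialLinearGroup.torus (a ^ i))) * z ^ i =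
      Module.finrank ℂ V - d) ∨
    (d = 2 ∧ ∑ i ∈ Finset.range p,
        LinearMap.trace ℂ V (ρ (Matrix.SpecialLinearGroup.torus (a ^ i))) * z ^ i =
      Module.finrank ℂ V - d + p) := by
  set n := Module.finrank ℂ V
  have hodd : Odd p := hp.odd_of_ne_two (by omega)
  set c : ℕ → ℂ := fun i =>
    LinearMap.trace ℂ V (ρ (Matrix.SpecialLinearGroup.torus (a ^ i))) with hc
  set s : Fˣ → ℂ := fun b =>
    LinearMap.trace ℂ V (ρ (Matrix.SpecialLinearGroup.torus b) * ρ.unipotentAverage) with hs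
  have hc0 : c 0 = n := by simp [hc, n]
  have hordA : orderOf a = p := orderOf_eq_prime_iff (hp := ⟨hp⟩) |>.2 ⟨ha, ha1⟩
  have hcs : ∀ i, i ∈ Finset.range p → i ≠ 0 → c i = s (a ^ i) := fun i hi hi0 => by
    refine (ρ.trace_torus_mul_unipotentAverage ?_).symm
    rw [← pow_mul]
    intro h
    have hdvd := orderOf_dvd_of_pow_eq_one h
    rw [hordA, hp.dvd_mul] at hdvd
    rcases hdvd with h | h
    · have := Nat.le_of_dvd (Nat.pos_of_ne_zero hi0) h
      have := Finset.mem_range.1 hi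
      omega
    · have := Nat.le_of_dvd two_pos h
      omega
  have hsum : ∀ y : ℂ, ∑ i ∈ Finset.range p, c i * y ^ i =
      n - s 1 + ∑ i ∈ Finset.range p, s (a ^ i) * y ^ i := fun y => by
    have h0 : 0 ∈ Finset.range p := Finset.mem_range.2 hp.pos
    rw [← Finset.add_sum_erase _ _ h0, ← Finset.add_sum_erase (Finset.range p)
      (fun i => s (a ^ i) * y ^ i) h0, Finset.sum_congr rfl fun i hi => by
        rw [hcs i (Finset.mem_of_mem_erase hi) (Finset.ne_of_mem_erase hi)], hc0]
    simp only [pow_zero, mul_one]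
    ring
  obtain ⟨m, hm⟩ := Module.End.exists_sum_trace_pow hp.ne_zero
    (ρ (Matrix.SpecialLinearGroup.torus a)) (by rw [← map_pow, ← map_pow, ha, map_one, map_one])
  have hcm : ∑ i ∈ Finset.range p, c i * 1 ^ i = p * m := by
    rw [← hm]
    refine Finset.sum_congr rfl fun i _ => ?_
    simp only [one_pow, mul_one, hc]
    rw [map_pow, map_pow]
  rw [hsum] at hcm
  have hmod : ∀ N k : ℕ, N ≤ 2 → (n : ℂ) - N + p * k = p * m → N = d := fun N k hN h => by
    have h' : n + p * k = p * m + N := by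
      have : (n : ℂ) + p * k = p * m + N := by linear_combination h
      exact_mod_cast this
    rw [← hdim, ← Nat.add_mul_mod_self_left n p k, h', Nat.mul_add_mod, Nat.mod_eq_of_lt (by omega)]
  have hsub : ∀ y : ℂ, y ^ p = 1 → y ^ 2 = 1 → y = 1 := fun y h1 h2 => by
    obtain ⟨k, rfl⟩ := hodd
    rwa [pow_succ, pow_mul, h2, one_pow, one_mul] at h1
  change (∑ i ∈ Finset.range p, c i * z ^ i = _) ∨ (_ ∧ ∑ i ∈ Finset.range p, c i * z ^ i = _)
  rw [hsum]
  rcases ρ.trace_torus_cases hirr with h | ⟨χ, h | h⟩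
  · have h' : ∀ b, s b = 0 := h
    left
    simp only [h', zero_mul, Finset.sum_const_zero, sub_zero, add_zero] at hcm ⊢
    rw [← hmod 0 0 (by omega) (by simpa using hcm)]
    simp
  · have h' : ∀ b, s b = χ b := h
    left
    have hr : χ a ^ p = 1 := by rw [← map_pow, ha, map_one]
    have hsymm : χ a = χ a⁻¹ := by
      have e1 := hcs 1 (Finset.mem_range.2 hp.one_lt) one_ne_zero
      have ha2 : (a⁻¹) ^ 2 ≠ 1 := by
        rw [inv_pow, inv_ne_one]
        intro h2
        have := Nat.le_of_dvd two_pos (hordA ▸ orderOf_dvd_of_pow_eq_one h2)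
        omega
      have e2 := ρ.trace_torus_mul_unipotentAverage ha2
      rw [← Matrix.SpecialLinearGroup.weyl_conj_torus, ρ.trace_conj_eq,
        Matrix.SpecialLinearGroup.weyl_conj_torus] at e2
      rw [← h', ← h', ← pow_one a, ← e1]
      simp only [hc, hs, pow_one]
      exact e2.symm
    have hr1 : χ a = 1 := hsub _ hr <| by
      rw [sq]
      nth_rewrite 2 [hsymm]
      rw [← map_mul, mul_inv_cancel, map_one]
    simp only [h', map_pow, hr1, one_pow, map_one, one_mul] at hcm ⊢
    rw [sum_range_pow_eq_ite hz, if_neg hz1, ← hmod 1 1 (by omega) (by simpa using hcm)]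
    simp
  · have h' : ∀ b, s b = χ b + χ b⁻¹ := h
    have hr : χ a ^ p = 1 := by rw [← map_pow, ha, map_one]
    have hr' : χ a⁻¹ ^ p = 1 := by rw [← map_pow, inv_pow, ha, inv_one, map_one]
    have hrr : χ a * χ a⁻¹ = 1 := by rw [← map_mul, mul_inv_cancel, map_one]
    have hexp : ∀ y : ℂ, y ^ p = 1 → ∑ i ∈ Finset.range p, s (a ^ i) * y ^ i =
        (if χ a * y = 1 then (p : ℂ) else 0) + if χ a⁻¹ * y = 1 then (p : ℂ) else 0 :=
      fun y hy => by
        rw [← sum_range_pow_eq_ite (by rw [mul_pow, hr, hy, one_mul]),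
          ← sum_range_pow_eq_ite (by rw [mul_pow, hr', hy, one_mul]), ← Finset.sum_add_distrib]
        refine Finset.sum_congr rfl fun i _ => ?_
        rw [h', ← inv_pow, map_pow, map_pow, mul_pow, mul_pow]
        ring
    have hs1 : s 1 = 2 := by rw [h', inv_one, map_one]; norm_num
    rw [hexp 1 (one_pow p), hs1] at hcm
    have hd2 : 2 = d := by
      split_ifs at hcm
      · exact hmod 2 2 le_rfl (by push_cast; linear_combination hcm)
      · exact hmod 2 1 le_rfl (by push_cast; linear_combination hcm)
      · exact hmod 2 1 le_rfl (by push_cast; linear_combination hcm)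
      · exact hmod 2 0 le_rfl (by push_cast; linear_combination hcm)
    subst hd2
    rw [hexp z hz, hs1]
    split_ifs with h1 h2
    · exact absurd (hsub z hz (by linear_combination χ a⁻¹ * z * h1 + h2 - z ^ 2 * hrr)) hz1
    all_goals simp

theorem induced_H7_multiplicities_q1mod7
    (q : ℕ) (hq : IsPrimePow q) (hgcd : Nat.Coprime q 42)
    (hq7 : q % 7 = 1 ∨ q % 7 = 6)
    (F : Type) [Field F] [Fintype F] (hF : Fintype.card F = q)
    (H2 H3 H7 : Subgroup (PSL2 F))
    (hH2 : Nat.card H2 = 2) (hH3 : Nat.card H3 = 3) (hH7 : Nat.card H7 = 7)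
    (θ2 : H2 →* ℂˣ) (θ3 : H3 →* ℂˣ) (θ7 : H7 →* ℂˣ)
    (hθ2 : Function.Injective θ2) (hθ3 : Function.Injective θ3)
    (hθ7 : Function.Injective θ7)
    (hq1 : q % 7 = 1) (k : ℕ) (hk : k ∈ Finset.Icc (1:ℕ) 6)
    (χ : PSL2 F → ℂ) (hχ : IsIrrCharacter (PSL2 F) χ)
    :
    ((χ 1 = (q : ℂ) - 1 ∨ χ 1 = (q : ℂ)) →
      restMult H7 (θ7 ^ k) χ = ((q : ℂ) - 1) / 7) ∧
    (χ 1 = (q : ℂ) + 1 →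
      restMult H7 (θ7 ^ k) χ = ((q : ℂ) - 1) / 7 ∨
      restMult H7 (θ7 ^ k) χ = ((q : ℂ) + 6) / 7) := by
  obtain ⟨V, hV, rfl⟩ := hχ
  have hprime : Nat.Prime 7 := by norm_num
  have hcyc : IsCyclic H7 := isCyclic_of_prime_card (hp := ⟨hprime⟩) hH7
  obtain ⟨h, hgen⟩ := IsCyclic.exists_generator (α := H7)
  have hord : orderOf h = 7 := hH7 ▸ orderOf_eq_card_of_forall_mem_zpowers hgen
  have hh7 : (h : PSL2 F) ^ 7 = 1 := by
    have := pow_orderOf_eq_one h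
    rw [hord] at this
    exact_mod_cast congrArg Subtype.val this
  have hh1 : (h : PSL2 F) ≠ 1 := by
    intro h1
    have h1' : h = 1 := Subtype.ext h1
    rw [h1', orderOf_one] at hord
    omega
  obtain ⟨ζ, hζ⟩ := FiniteField.exists_isPrimitiveRoot (F := F) (n := 7) (by omega)
  obtain ⟨P, a, hP, ha, ha1⟩ := exists_lift_eq_torus_conj (by decide) hζ hh7 hh1
  let ρ : Representation ℂ (Matrix.SpecialLinearGroup (Fin 2) F) V :=
    V.ρ.comp (QuotientGroup.mk' _)
  have hirr : ∀ S : Submodule ℂ V, S ≠ ⊥ → (∀ g, ∀ v ∈ S, ρ g v ∈ S) → S = ⊤ :=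
    fun S hS hinv => V.eq_top_of_invariant S hS fun g v hv => by
      obtain ⟨A, rfl⟩ := QuotientGroup.mk_surjective g
      exact hinv A v hv
  have hchar : ∀ i, V.character ((h : PSL2 F) ^ i) =
      LinearMap.trace ℂ V (ρ (Matrix.SpecialLinearGroup.torus (a ^ i))) := fun i => by
    rw [← ρ.trace_conj_eq P, map_pow, ← conj_pow, hP, ← QuotientGroup.mk_pow]
    rfl
  set z : ℂ := (((θ7 ^ k) h : ℂˣ) : ℂ)⁻¹ with hzdef
  have hz : z ^ 7 = 1 := by
    have h7 : h ^ 7 = 1 := hord ▸ pow_orderOf_eq_one h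
    rw [hzdef, inv_pow, ← Units.val_pow_eq_pow_val, ← map_pow, h7, map_one]
    simp
  have hz1 : z ≠ 1 := by
    rw [hzdef]
    intro h1
    have hu : (θ7 ^ k) h = 1 := Units.ext (inv_eq_one.1 h1)
    rw [MonoidHom.pow_apply, ← map_pow, ← map_one θ7] at hu
    have := Nat.le_of_dvd (by simp at hk; omega) (hord ▸ orderOf_dvd_of_pow_eq_one (hθ7 hu))
    simp at hk
    omega
  have hmult : restMult H7 (θ7 ^ k) V.character = (7 : ℂ)⁻¹ * ∑ i ∈ Finset.range 7,
      LinearMap.trace ℂ V (ρ (Matrix.SpecialLinearGroup.torus (a ^ i))) * z ^ i := by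
    rw [restMult_eq_sum_range H7 _ _ h hgen, hH7]
    simp_rw [hchar]
    rfl
  have key := fun d hd hdim => sum_trace_torus_pow ρ hirr (d := d) hprime (by norm_num) ha ha1 hd
    hdim hz hz1
  rw [hmult, V.char_one]
  refine ⟨?_, fun hdim => ?_⟩
  · rintro (hdim | hdim)
    · have hn : Module.finrank ℂ V + 1 = q := by
        have : (Module.finrank ℂ V : ℂ) + 1 = q := by rw [hdim]; ring
        exact_mod_cast this
      rcases key 0 (by omega) (by omega) with e | ⟨e, _⟩
      · rw [e, hdim]
        push_cast
        ring
      · omega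
    · have hn : Module.finrank ℂ V = q := by exact_mod_cast hdim
      rcases key 1 (by omega) (by omega) with e | ⟨e, _⟩
      · rw [e, hdim]
        push_cast
        ring
      · omega
  · have hn : Module.finrank ℂ V = q + 1 := by exact_mod_cast hdim
    rcases key 2 (by omega) (by omega) with e | ⟨_, e⟩
    · left
      rw [e, hdim]
      push_cast
      ring
    · right
      rw [e, hdim]
      push_cast
      ring
end

section
/- Suppose q ≡ −1 (mod 7). Then for every k ∈ {1,…,6} and every irreducible complex character χ of G: (a) if χ(1) = q+1 or χ(1) = q, then ⟨χ|_{H₇}, θ₇^k⟩ = (q+1)/7; (b) if χ(1) = q−1, then ⟨χ|_{H₇}, θ₇^k⟩ ∈ {(q+1)/7, (q−6)/7}. -/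
open scoped BigOperators Classical

/-- A finite commutative group has a complete orthogonal system of linear characters. -/
theorem exists_dual_system (Q : Type) [Group Q] [Fintype Q] [DecidableEq Q]
    (hcomm : ∀ a b : Q, a * b = b * a) :
    ∃ (ι : Type) (_ : Fintype ι) (ψ : ι → Q →* ℂˣ),
      (∀ i j, ∑ a, (ψ i a : ℂ) * (ψ j a : ℂ)⁻¹ = if i = j then (Fintype.card Q : ℂ) else 0) ∧
      (∀ a, ∑ i, (ψ i a : ℂ) = if a = 1 then (Fintype.card Q : ℂ) else 0) := by
  let _ : CommGroup Q := { (inferInstance : Group Q) with mul_comm := hcomm }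
  refine ⟨AddChar (Additive Q) ℂ, inferInstance,
    fun φ => MonoidHom.toHomUnits
      { toFun := fun a => φ (Additive.ofMul a)
        map_one' := φ.map_zero_eq_one
        map_mul' := fun a b => φ.map_add_eq_mul (Additive.ofMul a) (Additive.ofMul b) }, ?_, ?_⟩
  · intro φ φ'
    have := AddChar.sum_eq_ite (φ - φ')
    rw [← Equiv.sum_comp Additive.ofMul] at this
    simp only [AddChar.sub_apply', sub_eq_zero] at this
    simp only [Fintype.card_additive] at this
    convert this using 1
    refine Finset.sum_congr rfl fun a _ => ?_
    rw [div_eq_mul_inv]; rfl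
  · intro a
    have := AddChar.sum_apply_eq_ite (Additive.ofMul a)
    simp only [Fintype.card_additive] at this
    refine Eq.trans ?_ this
    rfl

theorem conj_linear_character {Q : Type} [Group Q] [Finite Q] (θ : Q →* ℂˣ) (a : Q) :
    (starRingEnd ℂ) (θ a : ℂ) = (θ a : ℂ)⁻¹ := by
  have h : ((θ a : ℂ)) ^ Nat.card Q = 1 := by
    rw [← Units.val_pow_eq_pow_val, ← map_pow, pow_card_eq_one', map_one, Units.val_one]
  rw [Complex.inv_def, Complex.normSq_eq_norm_sq,
    Complex.norm_eq_one_of_pow_eq_one h Nat.card_pos.ne']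
  simp

section Restriction

variable {Q : Type} [Group Q] [Fintype Q] {ι : Type} [Fintype ι] {ψ : ι → Q →* ℂˣ}

theorem card_dual_system [DecidableEq Q]
    (h₂ : ∀ a, ∑ i, (ψ i a : ℂ) = if a = 1 then (Fintype.card Q : ℂ) else 0) :
    Fintype.card ι = Fintype.card Q := by
  have := h₂ 1
  simp only [map_one, Units.val_one, Finset.sum_const, Finset.card_univ, nsmul_eq_mul,
    mul_one, if_true] at this
  exact_mod_cast this

/-- The multiplicity of a linear character in a representation is a natural number. -/
theorem exists_nat_multiplicity {G : Type} [Group G] (V : FDRep ℂ G) (j : Q →* G)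
    (θ : Q →* ℂˣ) :
    ∃ m : ℕ, ∑ a, V.character (j a) * (θ a : ℂ)⁻¹ = Fintype.card Q * (m : ℂ) := by
  have hne : (Nat.card Q : ℂ) ≠ 0 := by
    rw [Nat.card_eq_fintype_card]; exact_mod_cast Fintype.card_ne_zero
  have : Invertible (Nat.card Q : ℂ) := invertibleOfNonzero hne
  let σ : Representation ℂ Q ℂ :=
    ((Algebra.lmul ℂ ℂ : ℂ →* Module.End ℂ ℂ).comp (Units.coeHom ℂ)).comp θ
  let τ : Representation ℂ Q V := V.ρ.comp j
  have h := Representation.card_inv_mul_sum_char_mul_char_eq_finrank σ τ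
  refine ⟨Module.finrank ℂ (σ.IntertwiningMap τ), ?_⟩
  rw [← Nat.card_eq_fintype_card, ← h, mul_inv_cancel_left₀ hne]
  refine Finset.sum_congr rfl fun a _ => ?_
  have : σ.character a⁻¹ = (θ a : ℂ)⁻¹ := by
    have := Algebra.trace_self_apply (R := ℂ) ((θ a⁻¹ : ℂˣ) : ℂ)
    rw [Algebra.trace_apply] at this
    refine this.trans ?_
    simp
  rw [this]; rfl

theorem exists_character_eq_sum [DecidableEq Q] {G : Type} [Group G] (V : FDRep ℂ G) (j : Q →* G)
    (h₂ : ∀ a, ∑ i, (ψ i a : ℂ) = if a = 1 then (Fintype.card Q : ℂ) else 0) :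
    ∃ m : ι → ℕ, ∀ a, V.character (j a) = ∑ i, (m i : ℂ) * ψ i a := by
  choose m hm using fun i => exists_nat_multiplicity V j (ψ i)
  refine ⟨m, fun a => ?_⟩
  have hne : (Fintype.card Q : ℂ) ≠ 0 := by exact_mod_cast Fintype.card_ne_zero
  apply mul_left_cancel₀ hne
  rw [Finset.mul_sum]
  simp_rw [← mul_assoc, ← hm, Finset.sum_mul]
  rw [Finset.sum_comm]
  have (b : Q) : ∑ i, V.character (j b) * (ψ i b : ℂ)⁻¹ * (ψ i a : ℂ) =
      if b = a then V.character (j b) * Fintype.card Q else 0 := by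
    have := h₂ (b⁻¹ * a)
    simp only [map_mul, map_inv, Units.val_mul, inv_mul_eq_one] at this
    simp_rw [mul_assoc]
    rw [← Finset.mul_sum]
    simp only [Units.val_inv_eq_inv_val] at this
    rw [this]; split_ifs <;> simp
  simp_rw [this]
  simp [mul_comm]

theorem sum_normSq_eq
    (h₁ : ∀ i j, ∑ a, (ψ i a : ℂ) * (ψ j a : ℂ)⁻¹ = if i = j then (Fintype.card Q : ℂ) else 0)
    (m : ι → ℕ) :
    ∑ a, Complex.normSq (∑ i, (m i : ℂ) * ψ i a) = Fintype.card Q * ∑ i, (m i : ℝ) ^ 2 := by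
  have : (∑ a, (Complex.normSq (∑ i, (m i : ℂ) * ψ i a) : ℂ)) =
      Fintype.card Q * ∑ i, (m i : ℂ) ^ 2 := by
    simp_rw [Complex.normSq_eq_conj_mul_self, map_sum, map_mul, conj_linear_character,
      Finset.sum_mul_sum]
    rw [Finset.sum_comm]
    simp_rw [Finset.sum_comm (s := (Finset.univ : Finset Q))]
    rw [Finset.mul_sum]
    refine Finset.sum_congr rfl fun i _ => ?_
    have (k : ι) : ∑ a, (starRingEnd ℂ) (m i : ℂ) * (ψ i a : ℂ)⁻¹ * (m k * (ψ k a : ℂ)) =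
        m i * m k * if k = i then (Fintype.card Q : ℂ) else 0 := by
      rw [← h₁, Finset.mul_sum]
      refine Finset.sum_congr rfl fun a _ => ?_
      rw [Complex.conj_natCast]; ring
    simp_rw [this]
    simp; ring
  exact_mod_cast this

/-- A lower bound for the sum of the squared absolute values of a character over a commutative
group, from integrality of the multiplicities. -/
theorem sum_normSq_ge {G : Type} [Group G] (V : FDRep ℂ G) (j : Q →* G)
    (hcomm : ∀ a b : Q, a * b = b * a) {D : ℤ} (hD : V.character 1 = D) (r : ℤ) :
    ((Fintype.card Q * (|D - r * Fintype.card Q| + 2 * r * D - r ^ 2 * Fintype.card Q) : ℤ) : ℝ) ≤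
      ∑ a, Complex.normSq (V.character (j a)) := by
  obtain ⟨ι, _, ψ, h₁, h₂⟩ := exists_dual_system Q hcomm
  obtain ⟨m, hm⟩ := exists_character_eq_sum V j h₂
  simp_rw [hm]
  rw [sum_normSq_eq h₁ m]
  have hcard := card_dual_system h₂
  have hsum : ∑ i, (m i : ℤ) = D := by
    have := hm 1
    simp only [map_one, hD, Units.val_one, mul_one] at this
    exact_mod_cast this.symm
  have habs : |D - r * Fintype.card Q| ≤ ∑ i, ((m i : ℤ) - r) ^ 2 := by
    have : D - r * Fintype.card Q = ∑ i, ((m i : ℤ) - r) := by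
      rw [Finset.sum_sub_distrib, hsum]; simp [hcard]; ring
    rw [this]
    refine (Finset.abs_sum_le_sum_abs _ _).trans (Finset.sum_le_sum fun i _ => ?_)
    rw [← sq_abs]
    exact Int.le_self_sq _
  have hexp : ∑ i, ((m i : ℤ) - r) ^ 2 =
      ∑ i, (m i : ℤ) ^ 2 - 2 * r * D + r ^ 2 * Fintype.card Q := by
    simp_rw [sub_sq]
    rw [Finset.sum_add_distrib, Finset.sum_sub_distrib, ← hsum, Finset.mul_sum]
    simp [hcard, mul_comm, mul_left_comm]
  have : (Fintype.card Q : ℤ) * (|D - r * Fintype.card Q| + 2 * r * D - r ^ 2 * Fintype.card Q) ≤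
      Fintype.card Q * ∑ i, (m i : ℤ) ^ 2 := by
    apply mul_le_mul_of_nonneg_left _ (by positivity)
    linarith
  exact_mod_cast this

end Restriction

theorem character_inv {G : Type} [Group G] [Finite G] (V : FDRep ℂ G) (g : G) :
    V.character g⁻¹ = (starRingEnd ℂ) (V.character g) := by
  let _ : Fintype (Subgroup.zpowers g) := Fintype.ofFinite _
  obtain ⟨ι, _, ψ, h₁, h₂⟩ := exists_dual_system (Subgroup.zpowers g) mul_comm'
  obtain ⟨m, hm⟩ := exists_character_eq_sum V (Subgroup.zpowers g).subtype h₂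
  have h := hm ⟨g, Subgroup.mem_zpowers g⟩
  have h' := hm (⟨g, Subgroup.mem_zpowers g⟩⁻¹)
  simp only [map_inv, Subgroup.subtype_apply] at h h'
  rw [h, h', map_sum]
  simp [conj_linear_character]

theorem sum_normSq_irreducible {G : Type} [Group G] [Fintype G] (V : FDRep ℂ G)
    [CategoryTheory.Simple V] :
    ∑ g, Complex.normSq (V.character g) = Fintype.card G := by
  have hne : (Nat.card G : ℂ) ≠ 0 := by
    rw [Nat.card_eq_fintype_card]; exact_mod_cast Fintype.card_ne_zero
  have : Invertible (Nat.card G : ℂ) := invertibleOfNonzero hne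
  have := FDRep.char_orthonormal V V
  rw [if_pos ⟨CategoryTheory.Iso.refl _⟩, inv_mul_eq_one₀ hne] at this
  simp_rw [character_inv, Complex.mul_conj, Nat.card_eq_fintype_card] at this
  exact_mod_cast this.symm

section FiniteGroup

/-- Summing a pulled-back function along a surjective group homomorphism. -/
theorem sum_comp_of_surjective {A B : Type} [Group A] [Group B] [Fintype A] [Fintype B]
    (φ : A →* B) (hφ : Function.Surjective φ) (f : B → ℝ) :
    ∑ a, f (φ a) = Nat.card φ.ker * ∑ b, f b := by
  rw [← Finset.sum_fiberwise (s := Finset.univ) (g := φ), Finset.mul_sum]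
  refine Finset.sum_congr rfl fun b _ => ?_
  rw [Finset.sum_congr rfl (g := fun _ => f b)
    (fun a ha => by rw [(Finset.mem_filter.mp ha).2]), Finset.sum_const, nsmul_eq_mul,
    MonoidHom.card_fiber_eq_of_mem_range φ (hφ b) (hφ 1)]
  congr 2
  rw [Nat.card_eq_fintype_card, Fintype.card_subtype]
  simp [MonoidHom.mem_ker]

theorem card_eq_card_ker_mul {A B : Type} [Group A] [Group B] [Fintype A] [Fintype B]
    (φ : A →* B) (hφ : Function.Surjective φ) :
    Fintype.card A = Nat.card φ.ker * Fintype.card B := by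
  have := sum_comp_of_surjective φ hφ (fun _ => 1)
  simp only [Finset.sum_const, Finset.card_univ, nsmul_eq_mul, mul_one] at this
  exact_mod_cast this

/-- If every element of `A` is conjugated into `A` by at most `K` group elements,
the sum of a nonnegative class function over `A` is controlled by its sum over any set containing
all conjugates of `A`. -/
theorem card_mul_sum_le {S : Type} [Group S] [Fintype S] {f : S → ℝ} (hf₀ : ∀ g, 0 ≤ f g)
    (hf : ∀ g a, f (g * a * g⁻¹) = f a) (A X : Finset S) (K : ℕ)
    (hX : ∀ g, ∀ a ∈ A, g * a * g⁻¹ ∈ X)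
    (hK : ∀ a ∈ A, (Finset.univ.filter fun g => g⁻¹ * a * g ∈ A).card ≤ K) :
    Fintype.card S * ∑ a ∈ A, f a ≤ K * ∑ x ∈ X, f x := by
  have hK' (x : S) : (Finset.univ.filter fun g => g⁻¹ * x * g ∈ A).card ≤ K := by
    by_cases h : ∃ g₀, g₀⁻¹ * x * g₀ ∈ A
    · obtain ⟨g₀, h⟩ := h
      refine le_trans (Finset.card_le_card_of_injOn (fun g => g₀⁻¹ * g) ?_
        (mul_right_injective g₀⁻¹).injOn) (hK _ h)
      intro g hg
      have hg := (Finset.mem_filter.mp hg).2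
      simpa [mul_assoc] using hg
    · push Not at h
      rw [Finset.filter_false_of_mem (fun g _ => h g)]
      simp
  calc Fintype.card S * ∑ a ∈ A, f a = ∑ g : S, ∑ a ∈ A, f (g * a * g⁻¹) := by simp [hf]
    _ = ∑ g : S, ∑ x ∈ X, if g⁻¹ * x * g ∈ A then f x else 0 := by
        refine Finset.sum_congr rfl fun g _ => ?_
        rw [← Finset.sum_filter]
        refine Finset.sum_nbij' (fun a => g * a * g⁻¹) (fun x => g⁻¹ * x * g) ?_ ?_ ?_ ?_ ?_
        · intro a ha
          simpa [mul_assoc, ha] using hX g a ha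
        · intro x hx
          exact (Finset.mem_filter.mp hx).2
        · intro a _; simp [mul_assoc]
        · intro a _; simp [mul_assoc]
        · intro a _; rfl
    _ = ∑ x ∈ X, (Finset.univ.filter fun g => g⁻¹ * x * g ∈ A).card * f x := by
        rw [Finset.sum_comm]
        refine Finset.sum_congr rfl fun x _ => ?_
        rw [← Finset.sum_filter]; simp
    _ ≤ ∑ x ∈ X, K * f x :=
        Finset.sum_le_sum fun x _ => mul_le_mul_of_nonneg_right (by exact_mod_cast hK' x) (hf₀ x)
    _ = K * ∑ x ∈ X, f x := by rw [Finset.mul_sum]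

end FiniteGroup

section SL2

open Matrix

variable {F : Type} [Field F]

/-- The centralizer in `SL(2, F)` of a matrix `s`. -/
def torus (s : Matrix (Fin 2) (Fin 2) F) : Subgroup (Matrix.SpecialLinearGroup (Fin 2) F) where
  carrier := {g | Commute (g : Matrix (Fin 2) (Fin 2) F) s}
  mul_mem' := fun ha hb => by
    simpa using Commute.mul_left ha hb
  one_mem' := by simp
  inv_mem' := fun {g} hg => by
    have h : Commute ((Matrix.SpecialLinearGroup.toGL g : GL (Fin 2) F) : Matrix (Fin 2) (Fin 2) F) s := hg
    have := h.units_inv_left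
    rwa [← map_inv] at this

theorem mem_torus {s : Matrix (Fin 2) (Fin 2) F} {g : Matrix.SpecialLinearGroup (Fin 2) F} :
    g ∈ torus s ↔ (g : Matrix (Fin 2) (Fin 2) F) * s = s * g := Iff.rfl

/-- The group of matrices `± u` with `u` upper unitriangular. -/
def unipotents (F : Type) [Field F] : Subgroup (Matrix.SpecialLinearGroup (Fin 2) F) where
  carrier := {g | g 1 0 = 0 ∧ g 0 0 = g 1 1}
  mul_mem' := by
    rintro a b ⟨ha, ha'⟩ ⟨hb, hb'⟩
    simp [Matrix.mul_apply, Fin.sum_univ_two, ha, ha', hb, hb']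
  one_mem' := by simp
  inv_mem' := by
    rintro a ⟨ha, ha'⟩
    simp [Matrix.SpecialLinearGroup.coe_inv, adjugate_fin_two, ha, ha']

theorem mem_unipotents {g : Matrix.SpecialLinearGroup (Fin 2) F} :
    g ∈ unipotents F ↔ g 1 0 = 0 ∧ g 0 0 = g 1 1 := Iff.rfl

/-- The discriminant of the characteristic polynomial of an element of `SL(2, F)`. -/
def discSL (g : Matrix.SpecialLinearGroup (Fin 2) F) : F :=
  (g : Matrix (Fin 2) (Fin 2) F).trace ^ 2 - 4

theorem discSL_conj (g a : Matrix.SpecialLinearGroup (Fin 2) F) : discSL (g * a * g⁻¹) = discSL a := by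
  unfold discSL
  rw [Matrix.SpecialLinearGroup.coe_mul, trace_mul_comm, ← Matrix.SpecialLinearGroup.coe_mul, ← mul_assoc,
    inv_mul_cancel, one_mul]

theorem det_eq (g : Matrix.SpecialLinearGroup (Fin 2) F) : g 0 0 * g 1 1 - g 0 1 * g 1 0 = 1 := by
  rw [← det_fin_two]; exact g.2

theorem mem_center_SL2 {g : Matrix.SpecialLinearGroup (Fin 2) F} :
    g ∈ Subgroup.center (Matrix.SpecialLinearGroup (Fin 2) F) ↔ g = 1 ∨ g = -1 := by
  rw [Matrix.SpecialLinearGroup.mem_center_iff]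
  constructor
  · rintro ⟨r, hr, h⟩
    rw [Fintype.card_fin] at hr
    rcases sq_eq_one_iff.mp hr with rfl | rfl
    · left; ext i j; rw [← h]; simp
    · right; ext i j; rw [← h]; fin_cases i <;> fin_cases j <;> simp
  · rintro (rfl | rfl)
    · exact ⟨1, by simp, by simp⟩
    · refine ⟨-1, by simp, ?_⟩
      ext i j; fin_cases i <;> fin_cases j <;> simp

/-- A matrix commuting with a traceless invertible matrix `s` is a combination of `1` and `s`. -/
theorem exists_eq_of_commute (h2 : (2 : F) ≠ 0) {s M : Matrix (Fin 2) (Fin 2) F}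
    (hs : s.trace = 0) (hd : s.det ≠ 0) (h : M * s = s * M) :
    ∃ x y : F, M = x • 1 + y • s := by
  have hs1 : s 1 1 = - s 0 0 := by
    rw [trace_fin_two] at hs; linear_combination hs
  have e (i j) := congrFun (congrFun h i) j
  simp only [Matrix.mul_apply, Fin.sum_univ_two] at e
  have e00 := e 0 0
  have e01 := e 0 1
  have e10 := e 1 0
  rw [det_fin_two, hs1] at hd
  rw [hs1] at e01 e10
  refine ⟨(M 0 0 + M 1 1) / 2,
    (s 0 0 * M 0 0 + M 0 1 * s 1 0 + M 1 0 * s 0 1 - s 0 0 * M 1 1) /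
      (2 * -(s 0 0 * -s 0 0 - s 0 1 * s 1 0)), ?_⟩
  have hd' := neg_ne_zero.mpr hd
  ext i j
  fin_cases i <;> fin_cases j <;> simp [hs1] <;> field_simp <;> grind

theorem det_smul_one_add (s : Matrix (Fin 2) (Fin 2) F) (hs : s.trace = 0) (x y : F) :
    (x • (1 : Matrix (Fin 2) (Fin 2) F) + y • s).det = x ^ 2 + y ^ 2 * s.det := by
  rw [trace_fin_two] at hs
  simp [det_fin_two]
  linear_combination x * y * hs

theorem trace_smul_one_add (s : Matrix (Fin 2) (Fin 2) F) (hs : s.trace = 0) (x y : F) :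
    (x • (1 : Matrix (Fin 2) (Fin 2) F) + y • s).trace = 2 * x := by
  simp [hs, mul_comm]

/-- The element `x + y s` of `SL(2, F)`. -/
def torusElt (s : Matrix (Fin 2) (Fin 2) F) (hs : s.trace = 0) (x y : F)
    (h : x ^ 2 + y ^ 2 * s.det = 1) : Matrix.SpecialLinearGroup (Fin 2) F :=
  ⟨x • 1 + y • s, by rw [det_smul_one_add s hs, h]⟩

theorem exists_of_mem_torus (h2 : (2 : F) ≠ 0) {s : Matrix (Fin 2) (Fin 2) F}
    (hs : s.trace = 0) (hd : s.det ≠ 0) {g : Matrix.SpecialLinearGroup (Fin 2) F}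
    (hg : g ∈ torus s) :
    ∃ x y : F, x ^ 2 + y ^ 2 * s.det = 1 ∧
      (g : Matrix (Fin 2) (Fin 2) F) = x • 1 + y • s := by
  obtain ⟨x, y, h⟩ := exists_eq_of_commute h2 hs hd (mem_torus.mp hg)
  refine ⟨x, y, ?_, h⟩
  rw [← det_smul_one_add s hs, ← h, g.2]

theorem torus_comm (h2 : (2 : F) ≠ 0) {s : Matrix (Fin 2) (Fin 2) F}
    (hs : s.trace = 0) (hd : s.det ≠ 0) {a b : Matrix.SpecialLinearGroup (Fin 2) F}
    (ha : a ∈ torus s) (hb : b ∈ torus s) : a * b = b * a := by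
  obtain ⟨x, y, h⟩ := exists_eq_of_commute h2 hs hd (mem_torus.mp hb)
  apply Subtype.ext
  rw [Matrix.SpecialLinearGroup.coe_mul, Matrix.SpecialLinearGroup.coe_mul, h]
  simp [mul_add, add_mul, mem_torus.mp ha]

theorem unipotents_comm {a b : Matrix.SpecialLinearGroup (Fin 2) F}
    (ha : a ∈ unipotents F) (hb : b ∈ unipotents F) : a * b = b * a := by
  have h1 := ha.1
  have h2 := ha.2
  have h3 := hb.1
  have h4 := hb.2
  ext i j
  fin_cases i <;> fin_cases j <;>
    simp [Matrix.mul_apply, Fin.sum_univ_two, h1, h2, h3, h4] <;> ring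

theorem center_le_torus (s : Matrix (Fin 2) (Fin 2) F) :
    Subgroup.center (Matrix.SpecialLinearGroup (Fin 2) F) ≤ torus s := by
  intro g hg
  rcases mem_center_SL2.mp hg with rfl | rfl <;> simp [mem_torus]

theorem center_le_unipotents :
    Subgroup.center (Matrix.SpecialLinearGroup (Fin 2) F) ≤ unipotents F := by
  intro g hg
  rcases mem_center_SL2.mp hg with rfl | rfl <;> simp [mem_unipotents]

/-- The noncentral elements of a torus have discriminant `4 y² (- det s)`. -/
theorem discSL_of_mem_torus (h2 : (2 : F) ≠ 0) {s : Matrix (Fin 2) (Fin 2) F}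
    (hs : s.trace = 0) (hd : s.det ≠ 0) {g : Matrix.SpecialLinearGroup (Fin 2) F}
    (hg : g ∈ torus s) (hc : g ∉ Subgroup.center (Matrix.SpecialLinearGroup (Fin 2) F)) :
    ∃ y : F, y ≠ 0 ∧ discSL g = y ^ 2 * -s.det := by
  obtain ⟨x, y, h, hg⟩ := exists_of_mem_torus h2 hs hd hg
  refine ⟨2 * y, mul_ne_zero h2 ?_, ?_⟩
  · rintro rfl
    apply hc
    rw [Matrix.SpecialLinearGroup.mem_center_iff]
    refine ⟨x, by simpa using h, ?_⟩
    rw [hg]; simp [smul_one_eq_diagonal]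
  · rw [discSL, hg, trace_smul_one_add s hs]
    linear_combination 4 * h

theorem discSL_of_mem_unipotents {g : Matrix.SpecialLinearGroup (Fin 2) F}
    (hg : g ∈ unipotents F) : discSL g = 0 := by
  have := det_eq g
  rw [hg.1, ← hg.2] at this
  rw [discSL, trace_fin_two, ← hg.2]
  linear_combination 4 * this

theorem card_center_SL2 (h2 : (2 : F) ≠ 0) :
    Nat.card (Subgroup.center (Matrix.SpecialLinearGroup (Fin 2) F)) = 2 := by
  have : ((Subgroup.center (Matrix.SpecialLinearGroup (Fin 2) F) :
      Subgroup _) : Set (Matrix.SpecialLinearGroup (Fin 2) F)) = {1, -1} := by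
    ext g
    simp [mem_center_SL2]
  rw [← SetLike.coe_sort_coe, Nat.card_coe_set_eq, this, Set.ncard_pair]
  intro h
  have := congrArg (fun g : Matrix.SpecialLinearGroup (Fin 2) F => g 0 0) h
  simp at this
  apply h2
  linear_combination this

/-- The generator `2 g - tr g` of the torus containing `g`. -/
def torusGen (g : Matrix.SpecialLinearGroup (Fin 2) F) : Matrix (Fin 2) (Fin 2) F :=
  (2 : F) • (g : Matrix (Fin 2) (Fin 2) F) - (g : Matrix (Fin 2) (Fin 2) F).trace • 1

theorem trace_torusGen (g : Matrix.SpecialLinearGroup (Fin 2) F) : (torusGen g).trace = 0 := by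
  simp [torusGen, mul_comm]

theorem det_torusGen (g : Matrix.SpecialLinearGroup (Fin 2) F) :
    (torusGen g).det = -discSL g := by
  have := det_eq g
  simp [torusGen, discSL, det_fin_two, trace_fin_two]
  linear_combination 4 * this

theorem mem_torus_torusGen (g : Matrix.SpecialLinearGroup (Fin 2) F) :
    g ∈ torus (torusGen g) := by
  rw [mem_torus]
  simp [torusGen, mul_sub, sub_mul]

variable [Fintype F]

theorem card_SL2 :
    Fintype.card (Matrix.SpecialLinearGroup (Fin 2) F) =
      Fintype.card F * (Fintype.card F ^ 2 - 1) := by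
  have hsurj : Function.Surjective (GeneralLinearGroup.det : GL (Fin 2) F →* Fˣ) := by
    intro u
    refine ⟨GeneralLinearGroup.mkOfDetNeZero !![(u : F), 0; 0, 1] (by simp), ?_⟩
    ext
    simp [GeneralLinearGroup.mkOfDetNeZero]
  have h := card_eq_card_ker_mul _ hsurj
  rw [← Nat.card_eq_fintype_card (α := GL (Fin 2) F), Matrix.card_GL_field,
    Fintype.card_units] at h
  have hker : Nat.card (GeneralLinearGroup.det : GL (Fin 2) F →* Fˣ).ker =
      Fintype.card (Matrix.SpecialLinearGroup (Fin 2) F) := by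
    rw [← Nat.card_eq_fintype_card]
    refine (Nat.card_congr (Equiv.ofBijective
      (fun g : Matrix.SpecialLinearGroup (Fin 2) F =>
        (⟨Matrix.SpecialLinearGroup.toGL g, ?_⟩ :
          (GeneralLinearGroup.det : GL (Fin 2) F →* Fˣ).ker)) ⟨?_, ?_⟩)).symm
    · rw [MonoidHom.mem_ker]; ext; exact g.2
    · intro a b hab
      exact Matrix.SpecialLinearGroup.toGL_injective (congrArg Subtype.val hab)
    · rintro ⟨g, hg⟩
      refine ⟨⟨g, ?_⟩, ?_⟩
      · exact congrArg Units.val (MonoidHom.mem_ker.mp hg)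
      · apply Subtype.ext; ext; rfl
  rw [hker] at h
  have hq : 1 < Fintype.card F := Fintype.one_lt_card
  generalize Fintype.card F = q at *
  obtain ⟨r, rfl⟩ : ∃ r, q = r + 2 := ⟨q - 2, by omega⟩
  simp only [Fin.prod_univ_two, Fin.val_zero, Fin.val_one, pow_zero, pow_one] at h
  have e1 : (r + 2) ^ 2 - (r + 2) = (r + 2) * (r + 1) := by
    rw [Nat.sub_eq_iff_eq_add (by nlinarith)]; ring
  have e2 : r + 2 - 1 = r + 1 := rfl
  rw [e1, e2] at h
  have : 0 < r + 1 := by omega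
  apply Nat.eq_of_mul_eq_mul_right this
  rw [← h]; ring

/-- Coordinates on a torus. -/
theorem card_torus_eq_card_conic (h2 : (2 : F) ≠ 0) {s : Matrix (Fin 2) (Fin 2) F}
    (hs : s.trace = 0) (hd : s.det ≠ 0) :
    Fintype.card (torus s) = Fintype.card {p : F × F // p.1 ^ 2 + p.2 ^ 2 * s.det = 1} := by
  symm
  refine Fintype.card_of_bijective (f := fun p => (⟨torusElt s hs p.1.1 p.1.2 p.2, ?_⟩ : torus s))
    ⟨?_, ?_⟩
  · change (p.1.1 • (1 : Matrix (Fin 2) (Fin 2) F) + p.1.2 • s) * s =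
      s * (p.1.1 • (1 : Matrix (Fin 2) (Fin 2) F) + p.1.2 • s)
    simp [mul_add, add_mul]
  · rintro ⟨⟨x, y⟩, h⟩ ⟨⟨x', y'⟩, h'⟩ e
    have e : x • (1 : Matrix (Fin 2) (Fin 2) F) + y • s = x' • 1 + y' • s :=
      congrArg (fun t : torus s => (t : Matrix (Fin 2) (Fin 2) F)) e
    have hx : x = x' := by
      have := congrArg Matrix.trace e
      rw [trace_smul_one_add s hs, trace_smul_one_add s hs] at this
      exact mul_left_cancel₀ h2 this
    subst hx
    have hs0 : s ≠ 0 := by rintro rfl; simp at hd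
    have hy : y = y' := smul_left_injective F hs0 (add_left_cancel e)
    subst hy
    rfl
  · rintro ⟨g, hg⟩
    obtain ⟨x, y, h, e⟩ := exists_of_mem_torus h2 hs hd hg
    exact ⟨⟨(x, y), h⟩, Subtype.ext (Subtype.ext e.symm)⟩

theorem card_torus_of_not_isSquare (h2 : (2 : F) ≠ 0) {s : Matrix (Fin 2) (Fin 2) F}
    (hs : s.trace = 0) (hd : ¬ IsSquare (-s.det)) :
    Fintype.card (torus s) = Fintype.card F + 1 := by
  have hd0 : s.det ≠ 0 := by intro h; simp [h] at hd
  rw [card_torus_eq_card_conic h2 hs hd0, ← Fintype.card_option]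
  generalize s.det = δ at *
  have hne (m : F) : 1 + δ * m ^ 2 ≠ 0 := by
    intro h
    have hm : m ≠ 0 := by rintro rfl; simp at h
    exact hd ⟨m⁻¹, by field_simp; linear_combination -h⟩
  symm
  refine Fintype.card_of_bijective (f := fun o : Option F => o.elim ⟨(-1, 0), by simp⟩
    fun m => ⟨((1 - δ * m ^ 2) / (1 + δ * m ^ 2), 2 * m / (1 + δ * m ^ 2)), ?_⟩) ⟨?_, ?_⟩
  · have := hne m
    field_simp; ring
  · have key (m : F) : (1 - δ * m ^ 2) / (1 + δ * m ^ 2) ≠ -1 := by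
      have := hne m
      intro h
      field_simp at h
      apply h2
      linear_combination h
    rintro (_ | m) (_ | m') h
    · rfl
    · exact absurd (congrArg (fun p => p.1.1) h).symm (key m')
    · exact absurd (congrArg (fun p => p.1.1) h) (key m)
    · have e1 : (1 - δ * m ^ 2) / (1 + δ * m ^ 2) = (1 - δ * m' ^ 2) / (1 + δ * m' ^ 2) :=
        congrArg (fun p => p.1.1) h
      have e2 : 2 * m / (1 + δ * m ^ 2) = 2 * m' / (1 + δ * m' ^ 2) :=
        congrArg (fun p => p.1.2) h
      have key' (m : F) : m * ((1 - δ * m ^ 2) / (1 + δ * m ^ 2) + 1) =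
          2 * m / (1 + δ * m ^ 2) := by
        rw [div_add_one (hne m), mul_div_assoc']
        congr 1; ring
      have : m * ((1 - δ * m ^ 2) / (1 + δ * m ^ 2) + 1) =
          m' * ((1 - δ * m ^ 2) / (1 + δ * m ^ 2) + 1) := by
        rw [key', e2, e1, key']
      have h' := mul_right_cancel₀ (fun h => key m (eq_neg_of_add_eq_zero_left h)) this
      rw [h']
  · rintro ⟨⟨x, y⟩, h⟩
    simp only at h
    by_cases hx : x + 1 = 0
    · obtain rfl : x = -1 := eq_neg_of_add_eq_zero_left hx
      have : y = 0 := by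
        have : y ^ 2 * δ = 0 := by linear_combination h
        simpa [hd0] using this
      subst this
      exact ⟨none, rfl⟩
    · refine ⟨some (y / (x + 1)), ?_⟩
      have e : 1 + δ * (y / (x + 1)) ^ 2 = 2 / (x + 1) := by
        field_simp; linear_combination h
      have e' : 1 - δ * (y / (x + 1)) ^ 2 = 2 * x / (x + 1) := by
        field_simp; linear_combination -h
      apply Subtype.ext
      simp only [Option.elim, e, e']
      refine Prod.ext ?_ ?_ <;> simp only <;> field_simp

/-- The diagonal torus of `SL(2, F)`. -/
theorem card_torus_split (h2 : (2 : F) ≠ 0) :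
    Fintype.card (torus (!![1, 0; 0, -1] : Matrix (Fin 2) (Fin 2) F)) =
      Fintype.card F - 1 := by
  rw [card_torus_eq_card_conic h2 (by simp [trace_fin_two]) (by simp [det_fin_two]),
    ← Fintype.card_units]
  symm
  refine Fintype.card_of_bijective (f := fun u : Fˣ =>
    ⟨((u + (u : F)⁻¹) / 2, (u - (u : F)⁻¹) / 2), ?_⟩) ⟨?_, ?_⟩
  · have := u.ne_zero
    simp [det_fin_two]
    field_simp; ring
  · intro u v h
    have e1 : (u + (u : F)⁻¹) / 2 = (v + (v : F)⁻¹) / 2 := congrArg (fun p => p.1.1) h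
    have e2 : (u - (u : F)⁻¹) / 2 = (v - (v : F)⁻¹) / 2 := congrArg (fun p => p.1.2) h
    rw [div_left_inj' h2] at e1 e2
    ext
    apply mul_left_cancel₀ h2
    linear_combination e1 + e2
  · rintro ⟨⟨x, y⟩, h⟩
    simp [det_fin_two] at h
    have hu : (x + y) * (x - y) = 1 := by linear_combination h
    have hu' : (x - y) * (x + y) = 1 := by linear_combination h
    refine ⟨⟨x + y, x - y, hu, hu'⟩, ?_⟩
    apply Subtype.ext
    have : (x + y)⁻¹ = x - y := inv_eq_of_mul_eq_one_right hu
    refine Prod.ext ?_ ?_ <;> simp only [this] <;> field_simp <;> ring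

/-- The element `±u` of `SL(2, F)` with diagonal entries `e` and upper right entry `x`. -/
def unipotentElt (e x : F) (h : e ^ 2 = 1) : Matrix.SpecialLinearGroup (Fin 2) F :=
  ⟨!![e, x; 0, e], by simpa [sq] using h⟩

theorem card_unipotents (h2 : (2 : F) ≠ 0) :
    Fintype.card (unipotents F) = 2 * Fintype.card F := by
  have h1 : (1 : F) ≠ -1 := by
    intro h; apply h2; linear_combination h
  have hc : Fintype.card {e : F // e ^ 2 = 1} = 2 := by
    have : (Finset.univ.filter fun e : F => e ^ 2 = 1) = {1, -1} := by ext; simp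
    rw [Fintype.card_subtype, this, Finset.card_pair h1]
  suffices h : Fintype.card (unipotents F) = Fintype.card ({e : F // e ^ 2 = 1} × F) by
    rw [h, Fintype.card_prod, hc]
  symm
  refine Fintype.card_of_bijective (f := fun p : {e : F // e ^ 2 = 1} × F =>
    (⟨unipotentElt p.1.1 p.2 p.1.2, ?_⟩ : unipotents F)) ⟨?_, ?_⟩
  · exact ⟨rfl, rfl⟩
  · rintro ⟨⟨e, he⟩, x⟩ ⟨⟨e', he'⟩, x'⟩ h
    have h0 : e = e' := congrArg (fun g : unipotents F => (g : Matrix (Fin 2) (Fin 2) F) 0 0) h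
    have h1 : x = x' := congrArg (fun g : unipotents F => (g : Matrix (Fin 2) (Fin 2) F) 0 1) h
    subst h0 h1
    rfl
  · rintro ⟨g, hg, hg'⟩
    have hd := det_eq g
    rw [hg, ← hg'] at hd
    refine ⟨(⟨g 0 0, by linear_combination hd⟩, g 0 1), ?_⟩
    apply Subtype.ext
    ext i j
    fin_cases i <;> fin_cases j <;> simp [unipotentElt, hg, ← hg']

theorem card_filter_conj_mem_torus_le (h2 : (2 : F) ≠ 0) {s : Matrix (Fin 2) (Fin 2) F}
    (hs : s.trace = 0) (hd : s.det ≠ 0) {a : Matrix.SpecialLinearGroup (Fin 2) F}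
    (ha : a ∈ torus s) (hc : a ∉ Subgroup.center (Matrix.SpecialLinearGroup (Fin 2) F)) :
    (Finset.univ.filter fun g : Matrix.SpecialLinearGroup (Fin 2) F =>
      g⁻¹ * a * g ∈ torus s).card ≤ 2 * Fintype.card (torus s) := by
  obtain ⟨x, y, hxy, ea⟩ := exists_of_mem_torus h2 hs hd ha
  have hy : y ≠ 0 := by
    rintro rfl
    apply hc
    rw [Matrix.SpecialLinearGroup.mem_center_iff]
    exact ⟨x, by simpa using hxy, by rw [ea]; simp [smul_one_eq_diagonal]⟩
  have key (g : Matrix.SpecialLinearGroup (Fin 2) F) (hg : g⁻¹ * a * g ∈ torus s) :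
      s * g = g * s ∨ s * g = g * -s := by
    obtain ⟨x', y', hxy', e⟩ := exists_of_mem_torus h2 hs hd hg
    have htr : (a : Matrix (Fin 2) (Fin 2) F).trace =
        ((g⁻¹ * a * g : Matrix.SpecialLinearGroup (Fin 2) F) :
          Matrix (Fin 2) (Fin 2) F).trace := by
      rw [Matrix.SpecialLinearGroup.coe_mul, trace_mul_comm, ← Matrix.SpecialLinearGroup.coe_mul]
      simp
    rw [e, ea, trace_smul_one_add s hs, trace_smul_one_add s hs] at htr
    obtain rfl := mul_left_cancel₀ h2 htr
    have hmul : a * g = g * (g⁻¹ * a * g) := by group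
    have hmul := congrArg (fun t : Matrix.SpecialLinearGroup (Fin 2) F =>
      (t : Matrix (Fin 2) (Fin 2) F)) hmul
    simp only [Matrix.SpecialLinearGroup.coe_mul] at hmul e
    rw [e, ea, add_mul, mul_add, smul_mul_assoc, smul_mul_assoc, mul_smul_comm, mul_smul_comm,
      one_mul, mul_one, add_right_inj] at hmul
    have hyy : y = y' ∨ y = -y' := by
      apply sq_eq_sq_iff_eq_or_eq_neg.mp
      apply mul_right_cancel₀ hd
      linear_combination hxy - hxy'
    rcases hyy with rfl | rfl
    · exact Or.inl (smul_right_injective _ hy hmul)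
    · right
      apply smul_right_injective _ hy
      simpa using hmul
  have hsub : (Finset.univ.filter fun g : Matrix.SpecialLinearGroup (Fin 2) F =>
      g⁻¹ * a * g ∈ torus s) ⊆
      (Finset.univ.filter fun g : Matrix.SpecialLinearGroup (Fin 2) F => g ∈ torus s) ∪
      (Finset.univ.filter fun g : Matrix.SpecialLinearGroup (Fin 2) F =>
        s * (g : Matrix (Fin 2) (Fin 2) F) = g * -s) := by
    intro g hg
    simp only [Finset.mem_filter, Finset.mem_univ, true_and, Finset.mem_union] at hg ⊢
    exact (key g hg).imp (fun h => mem_torus.mpr h.symm) id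
  refine (Finset.card_le_card hsub).trans ((Finset.card_union_le _ _).trans ?_)
  have h1 : (Finset.univ.filter fun g : Matrix.SpecialLinearGroup (Fin 2) F =>
      g ∈ torus s).card = Fintype.card (torus s) := by
    rw [Fintype.card_subtype]
  rw [h1, two_mul]
  apply Nat.add_le_add_left
  rw [← h1]
  rcases Finset.eq_empty_or_nonempty (Finset.univ.filter
    fun g : Matrix.SpecialLinearGroup (Fin 2) F =>
        s * (g : Matrix (Fin 2) (Fin 2) F) = g * -s) with h | ⟨g₀, h⟩
  · rw [h]; simp
  · have h₀ := (Finset.mem_filter.mp h).2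
    refine Finset.card_le_card_of_injOn (fun g => g * g₀) ?_ (mul_left_injective g₀).injOn
    intro g hg
    have hg := (Finset.mem_filter.mp hg).2
    simp only [Finset.coe_filter, Finset.mem_univ, true_and, Set.mem_ofPred_eq, mem_torus,
      Matrix.SpecialLinearGroup.coe_mul]
    rw [mul_assoc, ← neg_inj, ← mul_neg, ← mul_neg, ← h₀, ← mul_assoc, ← mul_assoc, hg]
    simp

theorem card_filter_conj_mem_unipotents_le {a : Matrix.SpecialLinearGroup (Fin 2) F}
    (ha : a ∈ unipotents F)
    (hc : a ∉ Subgroup.center (Matrix.SpecialLinearGroup (Fin 2) F)) :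
    (Finset.univ.filter fun g : Matrix.SpecialLinearGroup (Fin 2) F =>
      g⁻¹ * a * g ∈ unipotents F).card ≤ (Fintype.card F - 1) * Fintype.card F := by
  have hb : a 0 1 ≠ 0 := by
    intro hb
    apply hc
    have := det_eq a
    rw [ha.1, ← ha.2] at this
    rw [Matrix.SpecialLinearGroup.mem_center_iff]
    refine ⟨a 0 0, by rw [Fintype.card_fin]; linear_combination this, ?_⟩
    ext i j
    fin_cases i <;> fin_cases j <;> simp [ha.1, hb, ← ha.2]
  have key (g : Matrix.SpecialLinearGroup (Fin 2) F) (hg : g⁻¹ * a * g ∈ unipotents F) :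
      g 1 0 = 0 := by
    have := hg.1
    simp [Matrix.mul_apply, Fin.sum_univ_two, adjugate_fin_two, Matrix.vecMul, dotProduct, ha.1,
      ← ha.2] at this
    have : a 0 1 * (g 1 0) ^ 2 = 0 := by linear_combination -this
    simpa [hb] using this
  have hcard : Fintype.card ({e : F // e ≠ 0} × F) = (Fintype.card F - 1) * Fintype.card F := by
    rw [Fintype.card_prod, Fintype.card_subtype_compl, Fintype.card_subtype_eq]
  rw [← hcard, ← Finset.card_univ]
  have hne (g : Matrix.SpecialLinearGroup (Fin 2) F) (h : g 1 0 = 0) : g 0 0 ≠ 0 := by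
    have hdet := det_eq g
    intro h0
    simp [h, h0] at hdet
  refine Finset.card_le_card_of_injOn
    (fun g => if h : g 0 0 ≠ 0 then (⟨g 0 0, h⟩, g 0 1) else (⟨1, one_ne_zero⟩, 0))
    (fun _ _ => Finset.mem_univ _) ?_
  intro g hg g' hg' e
  have hg := key g (Finset.mem_filter.mp hg).2
  have hg' := key g' (Finset.mem_filter.mp hg').2
  simp only [hne g hg, hne g' hg', ne_eq, not_false_eq_true, dite_true, Prod.mk.injEq,
    Subtype.mk.injEq] at e
  have hd := det_eq g
  have hd' := det_eq g'
  rw [hg, e.1] at hd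
  rw [hg'] at hd'
  have h11 : g 1 1 = g' 1 1 := by
    apply mul_left_cancel₀ (hne g' hg')
    linear_combination hd - hd'
  ext i j
  fin_cases i <;> fin_cases j <;> simp [hg, hg', e.1, e.2, h11]

/-- For a subgroup `H` of `SL(2, F)` whose noncentral elements fuse in at most `K` ways, a
nonnegative class function has sum over the noncentral part of `H` controlled by its sum over the
noncentral elements satisfying a conjugation-invariant property. -/
theorem card_mul_sum_subgroup_le {f : Matrix.SpecialLinearGroup (Fin 2) F → ℝ}
    (hf₀ : ∀ g, 0 ≤ f g) (hf : ∀ g a, f (g * a * g⁻¹) = f a)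
    (H : Subgroup (Matrix.SpecialLinearGroup (Fin 2) F))
    (hH : Subgroup.center (Matrix.SpecialLinearGroup (Fin 2) F) ≤ H) (K : ℕ)
    (hK : ∀ a ∈ H, a ∉ Subgroup.center (Matrix.SpecialLinearGroup (Fin 2) F) →
      (Finset.univ.filter fun g : Matrix.SpecialLinearGroup (Fin 2) F =>
        g⁻¹ * a * g ∈ H).card ≤ K)
    (P : F → Prop)
    (hP : ∀ a ∈ H, a ∉ Subgroup.center (Matrix.SpecialLinearGroup (Fin 2) F) → P (discSL a)) :
    Fintype.card (Matrix.SpecialLinearGroup (Fin 2) F) * (∑ a : H, f a -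
        ∑ z : Subgroup.center (Matrix.SpecialLinearGroup (Fin 2) F), f z) ≤
      K * ∑ x with x ∉ Subgroup.center (Matrix.SpecialLinearGroup (Fin 2) F) ∧ P (discSL x),
        f x := by
  have hsum : ∑ a : H, f a - ∑ z : Subgroup.center (Matrix.SpecialLinearGroup (Fin 2) F), f z =
      ∑ a with a ∈ H ∧ a ∉ Subgroup.center (Matrix.SpecialLinearGroup (Fin 2) F), f a := by
    rw [sub_eq_iff_eq_add',
      ← Finset.sum_subtype (Finset.univ.filter fun a => a ∈ H) (by simp) f,
      ← Finset.sum_subtype (Finset.univ.filter fun a =>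
        a ∈ Subgroup.center (Matrix.SpecialLinearGroup (Fin 2) F)) (by simp) f,
      ← Finset.sum_filter_add_sum_filter_not (Finset.univ.filter fun a => a ∈ H)
        (fun a => a ∈ Subgroup.center (Matrix.SpecialLinearGroup (Fin 2) F)),
      Finset.filter_filter, Finset.filter_filter]
    congr 2
    ext a
    simpa using fun h => hH h
  rw [hsum]
  have hcen (g a : Matrix.SpecialLinearGroup (Fin 2) F)
      (h : a ∉ Subgroup.center (Matrix.SpecialLinearGroup (Fin 2) F)) :
      g * a * g⁻¹ ∉ Subgroup.center (Matrix.SpecialLinearGroup (Fin 2) F) := by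
    intro h'
    apply h
    simpa [mul_assoc] using Subgroup.Normal.conj_mem inferInstance _ h' g⁻¹
  refine card_mul_sum_le hf₀ hf _ _ K ?_ ?_
  · intro g a ha
    obtain ⟨h1, h2⟩ := (Finset.mem_filter.mp ha).2
    simp only [Finset.mem_filter, Finset.mem_univ, true_and, discSL_conj]
    exact ⟨hcen g a h2, hP a h1 h2⟩
  · intro a ha
    obtain ⟨h1, h2⟩ := (Finset.mem_filter.mp ha).2
    refine (Finset.card_le_card ?_).trans (hK a h1 h2)
    intro g hg
    simp only [Finset.mem_filter, Finset.mem_univ, true_and] at hg ⊢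
    exact hg.1

/-- In `SL(2, q)` an element of prime order `p` not dividing `q (q - 1)` is nonsplit. -/
theorem not_isSquare_discSL (h2 : (2 : F) ≠ 0) {p : ℕ} (hp : (p : F) ≠ 0)
    (hpq : Nat.Coprime p (Fintype.card F - 1)) {g : Matrix.SpecialLinearGroup (Fin 2) F}
    (hg : g ^ p = 1) (hg1 : g ≠ 1) : ¬ IsSquare (discSL g) := by
  rintro ⟨r, hr⟩
  set M : Matrix (Fin 2) (Fin 2) F := (g : Matrix (Fin 2) (Fin 2) F) with hM
  have hMp : M ^ p = 1 := by
    rw [hM, ← Matrix.SpecialLinearGroup.coe_pow, hg, Matrix.SpecialLinearGroup.coe_one]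
  obtain ⟨a, ha⟩ : ∃ a : F, 2 * a = M.trace + r := ⟨(M.trace + r) / 2, by field_simp⟩
  have haq : a ^ 2 - M.trace * a + 1 = 0 := by
    have h4 : (2 : F) * 2 ≠ 0 := mul_ne_zero h2 h2
    apply mul_left_cancel₀ h4
    have : r * r = M.trace ^ 2 - 4 := hr.symm
    linear_combination (2 * a - M.trace + r) * ha + this
  have ha0 : a ≠ 0 := by rintro rfl; simp at haq
  have hdet : (M - a • 1).det = 0 := by
    have h := det_eq g
    have : (M - a • 1).det = a ^ 2 - M.trace * a + 1 := by
      simp [det_fin_two, trace_fin_two]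
      linear_combination h
    rw [this, haq]
  have hap : a ^ p = 1 := by
    have hcomm : Commute M (a • 1) := by simp [Commute, SemiconjBy]
    have h := hcomm.mul_geom_sum₂ p
    rw [hMp, smul_pow, one_pow] at h
    have h := congrArg Matrix.det h
    rw [det_mul, hdet, zero_mul] at h
    have : ((1 : Matrix (Fin 2) (Fin 2) F) - a ^ p • 1) = (1 - a ^ p) • 1 := by
      rw [sub_smul, one_smul]
    rw [this, det_smul, det_one, mul_one] at h
    have h := eq_zero_of_pow_eq_zero h.symm
    linear_combination -h
  have ha1 : a = 1 := by
    have h := FiniteField.pow_card_sub_one_eq_one a ha0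
    have h' := pow_gcd_eq_one.mpr ⟨hap, h⟩
    rwa [hpq, pow_one] at h'
  have htr : M.trace = 2 := by rw [ha1] at haq; linear_combination -haq
  have hN : (M - 1) * (M - 1) = 0 := by
    have h := det_eq g
    rw [trace_fin_two] at htr
    have e : M 1 1 = 2 - M 0 0 := by linear_combination htr
    have h : M 0 0 * M 1 1 - M 0 1 * M 1 0 = 1 := h
    rw [e] at h
    ext i j
    fin_cases i <;> fin_cases j <;> simp [Matrix.mul_apply, Fin.sum_univ_two, e]
    · linear_combination -h
    · ring
    · ring
    · linear_combination -h
  have hpow (n : ℕ) : M ^ n = 1 + n • (M - 1) := by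
    induction n with
    | zero => simp
    | succ n ih =>
      have h : (M - 1) * M = M - 1 := by rwa [mul_sub, mul_one, sub_eq_zero] at hN
      rw [pow_succ, ih, add_mul, one_mul, smul_mul_assoc, h, succ_nsmul]
      abel
  have := hpow p
  rw [hMp, left_eq_add, ← Nat.cast_smul_eq_nsmul F, smul_eq_zero] at this
  apply hg1
  apply Subtype.ext
  exact sub_eq_zero.mp (this.resolve_left hp)

/-- Elements of a nonsplit torus of `SL(2, F)` are conjugate to their inverses. -/
theorem exists_conj_eq_inv (hodd : Fintype.card F % 2 = 1) (h2 : (2 : F) ≠ 0)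
    {s : Matrix (Fin 2) (Fin 2) F}
    (hs : s.trace = 0) (hd : ¬ IsSquare (-s.det)) {c : Matrix.SpecialLinearGroup (Fin 2) F}
    (hc : c ∈ torus s) : ∃ g, g * c * g⁻¹ = c⁻¹ := by
  have hd0 : s.det ≠ 0 := by intro h; simp [h] at hd
  have hs1 : s 1 1 = - s 0 0 := by
    rw [trace_fin_two] at hs; linear_combination hs
  have hdet : s.det = -(s 0 0) ^ 2 - s 0 1 * s 1 0 := by
    rw [det_fin_two, hs1]; ring
  have hγ : s 1 0 ≠ 0 := by
    intro h
    apply hd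
    exact ⟨s 0 0, by rw [hdet, h]; ring⟩
  obtain ⟨X, z, hXz⟩ := FiniteField.exists_root_sum_quadratic (R := F)
    (f := Polynomial.C 1 * Polynomial.X ^ 2)
    (g := Polynomial.C s.det * Polynomial.X ^ 2 + Polynomial.C 0 * Polynomial.X +
      Polynomial.C (s 1 0 ^ 2))
    (Polynomial.degree_C_mul_X_pow 2 one_ne_zero) (Polynomial.degree_quadratic hd0) hodd
  simp only [map_one, one_mul, Polynomial.eval_pow, Polynomial.eval_X, map_zero, zero_mul,
    add_zero, Polynomial.eval_add, Polynomial.eval_mul, Polynomial.eval_C] at hXz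
  obtain ⟨x, hx⟩ : ∃ x, s 1 0 * x = X + s 0 0 * z := ⟨(X + s 0 0 * z) / s 1 0, by field_simp⟩
  obtain ⟨y, hy⟩ : ∃ y, s 1 0 * y = -(2 * s 0 0 * x + s 0 1 * z) :=
    ⟨-(2 * s 0 0 * x + s 0 1 * z) / s 1 0, by field_simp⟩
  have hg : (!![x, y; z, -x] : Matrix (Fin 2) (Fin 2) F).det = 1 := by
    rw [det_fin_two]
    simp only [of_apply, cons_val', cons_val_zero, cons_val_one, cons_val_fin_one]
    apply mul_left_cancel₀ (pow_ne_zero 2 hγ)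
    rw [hdet] at hXz
    obtain rfl : X = s 1 0 * x - s 0 0 * z := by linear_combination -hx
    linear_combination -hXz - s 1 0 * z * hy
  have hanti : s * !![x, y; z, -x] = -(!![x, y; z, -x] * s) := by
    ext i j
    fin_cases i <;> fin_cases j <;>
      simp [Matrix.mul_apply, Matrix.vecMul, dotProduct, Fin.sum_univ_two, hs1]
    · linear_combination hy
    · ring
    · ring
    · linear_combination hy
  obtain ⟨g, hgM⟩ : ∃ g : Matrix.SpecialLinearGroup (Fin 2) F,
      (g : Matrix (Fin 2) (Fin 2) F) = !![x, y; z, -x] := ⟨⟨_, hg⟩, rfl⟩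
  refine ⟨g, ?_⟩
  obtain ⟨u, v, huv, ec⟩ := exists_of_mem_torus h2 hs hd0 hc
  have hss : s * s = (-s.det) • 1 := by
    ext i j
    fin_cases i <;> fin_cases j <;>
      simp [Matrix.mul_apply, Fin.sum_univ_two, hs1, hdet] <;> ring
  have h (M : Matrix (Fin 2) (Fin 2) F) (hM : M * s = -(s * M)) :
      (u • 1 + v • s) * (M * (u • 1 + v • s)) = M := by
    rw [mul_add, mul_smul_comm, mul_smul_comm, mul_one, hM, smul_neg, ← sub_eq_add_neg,
      add_mul, mul_sub, mul_sub]
    simp only [smul_mul_assoc, mul_smul_comm, one_mul, ← mul_assoc, hss, smul_smul]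
    rw [mul_comm v u, sub_add_sub_cancel, ← sub_smul]
    convert one_smul F M using 2
    linear_combination huv
  rw [mul_inv_eq_iff_eq_mul, eq_inv_mul_iff_mul_eq]
  apply Subtype.ext
  simp only [Matrix.SpecialLinearGroup.coe_mul, ec]
  exact h _ (by rw [hgM, hanti, neg_neg])

/-- The projection from `SL(2, F)` to `PSL(2, F)`. -/
abbrev toPSL2 (F : Type) [Field F] : Matrix.SpecialLinearGroup (Fin 2) F →* PSL2 F :=
  QuotientGroup.mk' _

theorem sum_map_toPSL2 (h2 : (2 : F) ≠ 0) {H : Subgroup (Matrix.SpecialLinearGroup (Fin 2) F)}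
    (hH : Subgroup.center (Matrix.SpecialLinearGroup (Fin 2) F) ≤ H) (f : PSL2 F → ℝ) :
    ∑ a : H, f (toPSL2 F a) = 2 * ∑ b : H.map (toPSL2 F), f b := by
  have h := sum_comp_of_surjective ((toPSL2 F).subgroupMap H)
    ((toPSL2 F).subgroupMap_surjective H) (fun b => f b)
  rw [Subgroup.ker_subgroupMap, QuotientGroup.ker_mk',
    Nat.card_congr (Subgroup.subgroupOfEquivOfLe hH).toEquiv, card_center_SL2 h2] at h
  exact h

theorem card_eq_two_mul_card_map_toPSL2 (h2 : (2 : F) ≠ 0)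
    {H : Subgroup (Matrix.SpecialLinearGroup (Fin 2) F)}
    (hH : Subgroup.center (Matrix.SpecialLinearGroup (Fin 2) F) ≤ H) :
    Fintype.card H = 2 * Fintype.card (H.map (toPSL2 F)) := by
  have := sum_map_toPSL2 h2 hH (fun _ => 1)
  simp only [Finset.sum_const, Finset.card_univ, nsmul_eq_mul, mul_one] at this
  exact_mod_cast this

theorem sum_normSq_toPSL2 (V : FDRep ℂ (PSL2 F)) [CategoryTheory.Simple V] :
    ∑ g, Complex.normSq (V.character (toPSL2 F g)) =
      Fintype.card (Matrix.SpecialLinearGroup (Fin 2) F) := by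
  have hs : Function.Surjective (toPSL2 F) := QuotientGroup.mk'_surjective _
  rw [sum_comp_of_surjective (toPSL2 F) hs (fun b => Complex.normSq (V.character b)),
    sum_normSq_irreducible, card_eq_card_ker_mul (toPSL2 F) hs]
  push_cast
  rfl

theorem normSq_character_conj {G : Type} [Group G] (V : FDRep ℂ G) (g a : G) :
    Complex.normSq (V.character (g * a * g⁻¹)) = Complex.normSq (V.character a) := by
  rw [FDRep.char_conj]

theorem sum_normSq_center (h2 : (2 : F) ≠ 0) (V : FDRep ℂ (PSL2 F)) :
    ∑ z : Subgroup.center (Matrix.SpecialLinearGroup (Fin 2) F),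
      Complex.normSq (V.character (toPSL2 F z)) = 2 * Complex.normSq (V.character 1) := by
  have h (z : Subgroup.center (Matrix.SpecialLinearGroup (Fin 2) F)) : toPSL2 F z = 1 :=
    (QuotientGroup.eq_one_iff _).mpr z.2
  simp_rw [h]
  rw [Finset.sum_const, Finset.card_univ, ← Nat.card_eq_fintype_card, card_center_SL2 h2,
    nsmul_eq_mul, Nat.cast_two]

/-- The contributions of a subgroup `H` of `SL(2, F)` and of the center to the sum of the squared
absolute values of a character of `PSL(2, F)`. -/
theorem card_mul_sum_map_toPSL2_le (h2 : (2 : F) ≠ 0) (V : FDRep ℂ (PSL2 F))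
    (H : Subgroup (Matrix.SpecialLinearGroup (Fin 2) F))
    (hH : Subgroup.center (Matrix.SpecialLinearGroup (Fin 2) F) ≤ H) (K : ℕ)
    (hK : ∀ a ∈ H, a ∉ Subgroup.center (Matrix.SpecialLinearGroup (Fin 2) F) →
      (Finset.univ.filter fun g : Matrix.SpecialLinearGroup (Fin 2) F =>
        g⁻¹ * a * g ∈ H).card ≤ K)
    (P : F → Prop)
    (hP : ∀ a ∈ H, a ∉ Subgroup.center (Matrix.SpecialLinearGroup (Fin 2) F) → P (discSL a)) :
    Fintype.card (Matrix.SpecialLinearGroup (Fin 2) F) *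
      (2 * (∑ b : H.map (toPSL2 F), Complex.normSq (V.character b) -
        Complex.normSq (V.character 1))) ≤
      K * ∑ x with x ∉ Subgroup.center (Matrix.SpecialLinearGroup (Fin 2) F) ∧ P (discSL x),
        Complex.normSq (V.character (toPSL2 F x)) := by
  have h := card_mul_sum_subgroup_le
    (f := fun g => Complex.normSq (V.character (toPSL2 F g)))
    (fun _ => Complex.normSq_nonneg _)
    (fun g a => by rw [map_mul, map_mul, map_inv, normSq_character_conj]) H hH K hK P hP
  rw [sum_map_toPSL2 h2 hH (fun b => Complex.normSq (V.character b)), sum_normSq_center h2,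
    ← mul_sub] at h
  exact h

/-- The contributions of the unipotent, split and nonsplit elements to the norm of an irreducible
character of `PSL(2, F)`. -/
theorem sum_normSq_subgroups_le (h2 : (2 : F) ≠ 0) (V : FDRep ℂ (PSL2 F))
    [CategoryTheory.Simple V] {s : Matrix (Fin 2) (Fin 2) F} (hs : s.trace = 0)
    (hd : ¬ IsSquare (-s.det)) {q d P₀ P₁ P₂ : ℝ} (hq : q = Fintype.card F)
    (hdV : d = Complex.normSq (V.character 1))
    (hP₀ : P₀ = ∑ b : (unipotents F).map (toPSL2 F), Complex.normSq (V.character b))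
    (hP₁ : P₁ = ∑ b : (torus (!![1, 0; 0, -1] : Matrix (Fin 2) (Fin 2) F)).map (toPSL2 F),
      Complex.normSq (V.character b))
    (hP₂ : P₂ = ∑ b : (torus s).map (toPSL2 F), Complex.normSq (V.character b)) :
    2 * d + 2 * (q + 1) * (P₀ - d) + q * (q + 1) * (P₁ - d) + q * (q - 1) * (P₂ - d) ≤
      q * (q ^ 2 - 1) := by
  have hd0 : s.det ≠ 0 := by intro h; simp [h] at hd
  have hq1 : 1 < Fintype.card F := Fintype.one_lt_card
  have hqpos : 1 < q := by rw [hq]; exact_mod_cast hq1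
  have hcS : (Fintype.card (Matrix.SpecialLinearGroup (Fin 2) F) : ℝ) = q * (q ^ 2 - 1) := by
    rw [card_SL2, hq, Nat.cast_mul, Nat.cast_sub (Nat.one_le_pow _ _ hq1.le), Nat.cast_pow,
      Nat.cast_one]
  have hU := card_mul_sum_map_toPSL2_le h2 V (unipotents F) center_le_unipotents _
    (fun a ha hc => card_filter_conj_mem_unipotents_le ha hc) (fun t => t = 0)
    (fun a ha _ => discSL_of_mem_unipotents ha)
  have hsplit : (!![1, 0; 0, -1] : Matrix (Fin 2) (Fin 2) F).trace = 0 := by simp [trace_fin_two]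
  have hsplit' : (!![1, 0; 0, -1] : Matrix (Fin 2) (Fin 2) F).det = -1 := by simp [det_fin_two]
  have hsplit0 : (!![1, 0; 0, -1] : Matrix (Fin 2) (Fin 2) F).det ≠ 0 := by simp [hsplit']
  have hT := card_mul_sum_map_toPSL2_le h2 V _
    (center_le_torus (!![1, 0; 0, -1] : Matrix (Fin 2) (Fin 2) F)) _
    (fun a ha hc => card_filter_conj_mem_torus_le h2 hsplit hsplit0 ha hc)
    (fun t => t ≠ 0 ∧ IsSquare t) (fun a ha hc => by
      obtain ⟨y, hy, e⟩ := discSL_of_mem_torus h2 hsplit hsplit0 ha hc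
      rw [e, hsplit', neg_neg, mul_one]
      exact ⟨pow_ne_zero 2 hy, y, sq y⟩)
  have hC := card_mul_sum_map_toPSL2_le h2 V _ (center_le_torus s) _
    (fun a ha hc => card_filter_conj_mem_torus_le h2 hs hd0 ha hc)
    (fun t => t ≠ 0 ∧ ¬ IsSquare t) (fun a ha hc => by
      obtain ⟨y, hy, e⟩ := discSL_of_mem_torus h2 hs hd0 ha hc
      rw [e]
      refine ⟨mul_ne_zero (pow_ne_zero 2 hy) (neg_ne_zero.mpr hd0), ?_⟩
      rintro ⟨r, hr⟩
      exact hd ⟨r / y, by field_simp; linear_combination hr⟩)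
  have htot := sum_normSq_toPSL2 V
  rw [← Finset.sum_filter_add_sum_filter_not Finset.univ
    (fun x => x ∈ Subgroup.center (Matrix.SpecialLinearGroup (Fin 2) F)),
    ← Finset.sum_filter_add_sum_filter_not (Finset.univ.filter fun x =>
      x ∉ Subgroup.center (Matrix.SpecialLinearGroup (Fin 2) F)) (fun x => discSL x = 0),
    ← Finset.sum_filter_add_sum_filter_not ((Finset.univ.filter fun x =>
      x ∉ Subgroup.center (Matrix.SpecialLinearGroup (Fin 2) F)).filter fun x =>
        ¬ discSL x = 0) (fun x => IsSquare (discSL x)),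
    Finset.filter_filter, Finset.filter_filter, Finset.filter_filter, Finset.filter_filter,
    Finset.filter_filter, Finset.sum_subtype (p := fun x => x ∈ Subgroup.center (Matrix.SpecialLinearGroup (Fin 2) F))
      (Finset.univ.filter fun a =>
        a ∈ Subgroup.center (Matrix.SpecialLinearGroup (Fin 2) F)) (by simp),
    sum_normSq_center h2, hcS, ← hdV] at htot
  rw [hcS, ← hdV, ← hP₀, Nat.cast_mul, Nat.cast_sub hq1.le, ← hq, Nat.cast_one] at hU
  rw [hcS, ← hdV, ← hP₁, Nat.cast_mul, card_torus_split h2, Nat.cast_sub hq1.le, ← hq,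
    Nat.cast_one, Nat.cast_two] at hT
  rw [hcS, ← hdV, ← hP₂, Nat.cast_mul, card_torus_of_not_isSquare h2 hs hd, Nat.cast_add, ← hq,
    Nat.cast_one, Nat.cast_two] at hC
  generalize hX₀ : @Finset.sum (Matrix.SpecialLinearGroup (Fin 2) F) ℝ _ _ _ = X₀ at hU
  generalize hX₁ : @Finset.sum (Matrix.SpecialLinearGroup (Fin 2) F) ℝ _ _ _ = X₁ at hT
  generalize hX₂ : @Finset.sum (Matrix.SpecialLinearGroup (Fin 2) F) ℝ _ _ _ = X₂ at hC
  have hX : 2 * d + (X₀ + (X₁ + X₂)) = q * (q ^ 2 - 1) := by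
    rw [← hX₀, ← hX₁, ← hX₂]
    convert htot
  replace hU := le_of_mul_le_mul_left (a := (q - 1) * q) (b := 2 * (q + 1) * (P₀ - d)) (c := X₀)
    (by linarith) (by nlinarith)
  replace hT := le_of_mul_le_mul_left (a := 2 * (q - 1)) (b := q * (q + 1) * (P₁ - d)) (c := X₁)
    (by linarith) (by linarith)
  replace hC := le_of_mul_le_mul_left (a := 2 * (q + 1)) (b := q * (q - 1) * (P₂ - d)) (c := X₂)
    (by linarith) (by linarith)
  linarith

/-- Let `q + 1 - δ` be the degree of an irreducible character of `PSL(2, q)`, where `δ ≤ 2`. Its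
restriction to the image of a nonsplit torus is twice the regular character minus `δ` distinct
linear characters. -/
theorem multiplicity_torus (h2 : (2 : F) ≠ 0) (V : FDRep ℂ (PSL2 F))
    [CategoryTheory.Simple V] {s : Matrix (Fin 2) (Fin 2) F} (hs : s.trace = 0)
    (hd : ¬ IsSquare (-s.det)) {δ : ℕ} (hδ : δ ≤ 2)
    (hV : V.character 1 = (Fintype.card F : ℂ) + 1 - δ)
    {ι : Type} [Fintype ι] {ψ : ι → (torus s).map (toPSL2 F) →* ℂˣ}
    (h₁ : ∀ i j, ∑ a, (ψ i a : ℂ) * (ψ j a : ℂ)⁻¹ =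
      if i = j then (Fintype.card ((torus s).map (toPSL2 F)) : ℂ) else 0)
    (h₂ : ∀ a, ∑ i, (ψ i a : ℂ) =
      if a = 1 then (Fintype.card ((torus s).map (toPSL2 F)) : ℂ) else 0)
    {m : ι → ℕ} (hm : ∀ a : (torus s).map (toPSL2 F),
      V.character a = ∑ i, (m i : ℂ) * ψ i a) :
    ∑ i, (2 - m i : ℤ) = δ ∧ ∑ i, (2 - m i : ℤ) ^ 2 ≤ δ := by
  have hq1 : 1 < Fintype.card F := Fintype.one_lt_card
  have hcU := card_eq_two_mul_card_map_toPSL2 h2 (center_le_unipotents (F := F))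
  rw [card_unipotents h2] at hcU
  have hcT := card_eq_two_mul_card_map_toPSL2 h2
    (center_le_torus (!![1, 0; 0, -1] : Matrix (Fin 2) (Fin 2) F))
  rw [card_torus_split h2] at hcT
  have hcC := card_eq_two_mul_card_map_toPSL2 h2 (center_le_torus s)
  rw [card_torus_of_not_isSquare h2 hs hd] at hcC
  have hVD : V.character 1 = ((Fintype.card F + 1 - δ : ℤ) : ℂ) := by rw [hV]; push_cast; rfl
  have hcommU : ∀ a b : (unipotents F).map (toPSL2 F), a * b = b * a := by
    rintro ⟨_, a, ha, rfl⟩ ⟨_, b, hb, rfl⟩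
    apply Subtype.ext
    simpa using congrArg (toPSL2 F) (unipotents_comm ha hb)
  have hcommT : ∀ a b : (torus (!![1, 0; 0, -1] : Matrix (Fin 2) (Fin 2) F)).map (toPSL2 F),
      a * b = b * a := by
    rintro ⟨_, a, ha, rfl⟩ ⟨_, b, hb, rfl⟩
    apply Subtype.ext
    simpa using congrArg (toPSL2 F)
      (torus_comm h2 (by simp [trace_fin_two]) (by simp [det_fin_two]) ha hb)
  have hU := sum_normSq_ge V ((unipotents F).map (toPSL2 F)).subtype hcommU hVD 1
  have hT := sum_normSq_ge V
    ((torus (!![1, 0; 0, -1] : Matrix (Fin 2) (Fin 2) F)).map (toPSL2 F)).subtype hcommT hVD 2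
  have hC := sum_normSq_eq h₁ m
  simp_rw [← hm] at hC
  have hle := sum_normSq_subgroups_le h2 V hs hd rfl rfl rfl rfl rfl
  have hnorm : Complex.normSq (V.character 1) = ((Fintype.card F : ℝ) + 1 - δ) ^ 2 := by
    rw [hVD, Complex.normSq_intCast]; push_cast; ring
  have hcι := card_dual_system h₂
  have hsum : ∑ i, (m i : ℤ) = Fintype.card F + 1 - δ := by
    have := hm 1
    simp only [map_one, Units.val_one, mul_one, Subgroup.coe_one, hVD] at this
    exact_mod_cast this.symm
  simp only [Subgroup.subtype_apply] at hU hT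
  rw [hnorm, hC] at hle
  generalize (∑ b : (unipotents F).map (toPSL2 F), Complex.normSq (V.character b)) = P₀ at hU hle
  generalize (∑ b : (torus (!![1, 0; 0, -1] : Matrix (Fin 2) (Fin 2) F)).map (toPSL2 F),
    Complex.normSq (V.character b)) = P₁ at hT hle
  generalize Fintype.card ((unipotents F).map (toPSL2 F)) = nU at hU hcU
  generalize Fintype.card ((torus (!![1, 0; 0, -1] : Matrix (Fin 2) (Fin 2) F)).map
    (toPSL2 F)) = nT at hT hcT
  generalize Fintype.card ((torus s).map (toPSL2 F)) = n at hcC hle hcι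
  generalize Fintype.card F = q at *
  have hsumd : ∑ i, (2 - m i : ℤ) = δ := by
    rw [Finset.sum_sub_distrib, hsum, Finset.sum_const, Finset.card_univ, hcι, nsmul_eq_mul]
    omega
  refine ⟨hsumd, ?_⟩
  obtain rfl : nU = q := by omega
  have hnT : (nT : ℤ) * 2 = nU - 1 := by omega
  have hnT' : (nT : ℝ) * 2 = nU - 1 := by exact_mod_cast hnT
  have hn : (n : ℝ) * 2 = nU + 1 := by exact_mod_cast (by omega : n * 2 = nU + 1)
  have hsq : ∑ i, (m i : ℝ) ^ 2 =
      ((∑ i, (2 - m i : ℤ) ^ 2 : ℤ) : ℝ) + 2 * (nU + 1) - 4 * δ := by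
    have hι : (Fintype.card ι : ℝ) * 2 = nU + 1 := by rw [hcι, hn]
    have hsumR : ∑ i, (m i : ℝ) = nU + 1 - δ := by exact_mod_cast hsum
    push_cast
    simp_rw [sub_sq]
    rw [Finset.sum_add_distrib, Finset.sum_sub_distrib, ← Finset.mul_sum, hsumR,
      Finset.sum_const, Finset.card_univ, nsmul_eq_mul]
    linear_combination -2 * hι
  generalize (∑ i, (2 - m i : ℤ) ^ 2) = x at *
  rw [hsq] at hle
  have hqpos : (1 : ℝ) < nU := by exact_mod_cast hq1
  have habs : |(nU : ℤ) + 1 - δ - 2 * nT| = 2 - δ := by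
    rw [abs_of_nonneg (by omega)]; omega
  have habs' : |(nU : ℤ) + 1 - δ - 1 * nU| = |1 - (δ : ℤ)| := by congr 1; ring
  rw [habs] at hT
  rw [habs'] at hU
  have hx : (nU * (nU ^ 2 - 1) * x : ℝ) ≤ nU * (nU ^ 2 - 1) * δ := by
    have hn' : (n : ℝ) = (nU + 1) / 2 := by linarith
    have hnT'' : (nT : ℝ) = (nU - 1) / 2 := by linarith
    interval_cases δ
    all_goals
      norm_num at hU hT hle ⊢
      rw [hnT''] at hT
      rw [hn'] at hle
      have hU' := mul_le_mul_of_nonneg_left hU (by linarith : (0:ℝ) ≤ 2 * (nU + 1))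
      have hT' := mul_le_mul_of_nonneg_left hT (by nlinarith : (0:ℝ) ≤ nU * (nU + 1))
      linarith
  have := le_of_mul_le_mul_left hx (by nlinarith [sq_nonneg (nU - 1 : ℝ)])
  exact_mod_cast this

/-- Multiplicities along a restriction `j : K → Q`, for a character of `Q` given by its
multiplicities `m` compared with `r` times the regular character. -/
theorem sum_restrict_mul_inv {Q K ι : Type} [Group Q] [Fintype Q] [DecidableEq Q] [Group K]
    [Fintype K] [Fintype ι] {ψ : ι → Q →* ℂˣ}
    (h₂ : ∀ a, ∑ i, (ψ i a : ℂ) = if a = 1 then (Fintype.card Q : ℂ) else 0) (m : ι → ℕ) (r : ℤ)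
    {j : K →* Q} (hj : Function.Injective j) (θ : K →* ℂˣ) :
    ∑ h, (∑ i, (m i : ℂ) * ψ i (j h)) * (θ h : ℂ)⁻¹ =
      r * Fintype.card Q -
        Fintype.card K * ((∑ i with (ψ i).comp j = θ, (r - m i) : ℤ) : ℂ) := by
  have hreg : ∑ h, (∑ i, (r : ℂ) * ψ i (j h)) * (θ h : ℂ)⁻¹ = r * Fintype.card Q := by
    simp_rw [← Finset.mul_sum, h₂, map_eq_one_iff j hj]
    rw [Finset.sum_eq_single 1 (fun h _ hh => by simp [hh]) (by simp)]
    simp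
  have hdual (i : ι) : ∑ h, (ψ i (j h) : ℂ) * (θ h : ℂ)⁻¹ =
      if (ψ i).comp j = θ then (Fintype.card K : ℂ) else 0 := by
    have := sum_hom_units ((Units.coeHom ℂ).comp ((ψ i).comp j * θ⁻¹))
    have hone : (Units.coeHom ℂ).comp ((ψ i).comp j * θ⁻¹) = 1 ↔ (ψ i).comp j = θ := by
      rw [← mul_inv_eq_one (a := (ψ i).comp j), ← MonoidHom.comp_one (Units.coeHom ℂ)]
      exact MonoidHom.cancel_left Units.val_injective
    rw [if_congr hone rfl rfl] at this
    simpa using this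
  have hdiff : ∑ h, (∑ i, (r : ℂ) * ψ i (j h)) * (θ h : ℂ)⁻¹ -
      ∑ h, (∑ i, (m i : ℂ) * ψ i (j h)) * (θ h : ℂ)⁻¹ =
      Fintype.card K * ((∑ i with (ψ i).comp j = θ, (r - m i) : ℤ) : ℂ) := by
    simp_rw [← Finset.sum_sub_distrib, ← sub_mul, ← Finset.sum_sub_distrib, ← sub_mul,
      Finset.sum_mul]
    rw [Finset.sum_comm]
    simp_rw [mul_assoc, ← Finset.mul_sum, hdual]
    push_cast
    rw [Finset.sum_filter, Finset.mul_sum]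
    refine Finset.sum_congr rfl fun i _ => ?_
    split_ifs <;> ring
  rw [← hdiff, hreg]
  ring

/-- A character of `PSL(2, F)` takes the same value at `x` and `x⁻¹` when `x` lies in the image of a
nonsplit torus. -/
theorem character_inv_of_mem_map_torus (hodd : Fintype.card F % 2 = 1) (h2 : (2 : F) ≠ 0)
    (V : FDRep ℂ (PSL2 F)) {s : Matrix (Fin 2) (Fin 2) F} (hs : s.trace = 0)
    (hd : ¬ IsSquare (-s.det)) {x : PSL2 F} (hx : x ∈ (torus s).map (toPSL2 F)) :
    V.character x⁻¹ = V.character x := by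
  obtain ⟨c, hc, rfl⟩ := hx
  obtain ⟨g, hg⟩ := exists_conj_eq_inv hodd h2 hs hd hc
  rw [← map_inv, ← hg, map_mul, map_mul, map_inv, FDRep.char_conj]

/-- A subgroup of `PSL(2, q)` of odd prime order dividing `q + 1` lies in the image of a nonsplit
torus. -/
theorem exists_le_map_torus (h2 : (2 : F) ≠ 0) {p : ℕ} (hp : p.Prime) (hp2 : p ≠ 2)
    (hpq : p ∣ Fintype.card F + 1) (H : Subgroup (PSL2 F)) (hH : Nat.card H = p) :
    ∃ s : Matrix (Fin 2) (Fin 2) F, s.trace = 0 ∧ ¬ IsSquare (-s.det) ∧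
      H ≤ (torus s).map (toPSL2 F) := by
  have : Fact p.Prime := ⟨hp⟩
  have hpF : (p : F) ≠ 0 := by
    intro h
    have h1 : ((Fintype.card F + 1 : ℕ) : F) = 0 := by
      obtain ⟨c, hc⟩ := hpq
      rw [hc, Nat.cast_mul, h, zero_mul]
    simp at h1
  have hcop : Nat.Coprime p (Fintype.card F - 1) := by
    rw [hp.coprime_iff_not_dvd]
    intro h
    apply hp2
    have hq := Fintype.one_lt_card (α := F)
    have := Nat.dvd_sub hpq h
    rw [show Fintype.card F + 1 - (Fintype.card F - 1) = 2 by omega] at this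
    exact (Nat.prime_dvd_prime_iff_eq hp Nat.prime_two).mp this
  have : Nontrivial H := by
    rw [← Finite.one_lt_card_iff_nontrivial, hH]
    exact hp.one_lt
  obtain ⟨y, hy⟩ := exists_ne (1 : H)
  have hyp : y ^ p = 1 := by rw [← hH]; exact pow_card_eq_one'
  obtain ⟨g, hg, hgp⟩ : ∃ g, toPSL2 F g = y ∧ g ^ p = 1 := by
    obtain ⟨g, hg⟩ := QuotientGroup.mk'_surjective
      (Subgroup.center (Matrix.SpecialLinearGroup (Fin 2) F)) y
    have hgp : g ^ p ∈ Subgroup.center (Matrix.SpecialLinearGroup (Fin 2) F) := by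
      rw [← QuotientGroup.eq_one_iff]
      have : toPSL2 F (g ^ p) = 1 := by
        rw [map_pow]
        have := congrArg Subtype.val hyp
        rw [Subgroup.coe_pow, Subgroup.coe_one, ← hg] at this
        exact this
      exact this
    rcases mem_center_SL2.mp hgp with h | h
    · exact ⟨g, hg, h⟩
    · refine ⟨-g, ?_, ?_⟩
      · have h1 : toPSL2 F (-1) = 1 :=
          (QuotientGroup.eq_one_iff _).mpr (mem_center_SL2.mpr (.inr rfl))
        rw [← neg_one_mul, map_mul, h1, one_mul]
        exact hg
      · rw [(hp.odd_of_ne_two hp2).neg_pow, h, neg_neg]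
  have hg1 : g ≠ 1 := by
    rintro rfl
    apply hy
    apply Subtype.ext
    rw [← hg]
    simp
  refine ⟨torusGen g, trace_torusGen g, ?_, ?_⟩
  · rw [det_torusGen, neg_neg]
    exact not_isSquare_discSL h2 hpF hcop hgp hg1
  · intro x hx
    obtain ⟨n, hn⟩ := Subgroup.mem_zpowers_iff.mp (mem_zpowers_of_prime_card hH hy (g' := ⟨x, hx⟩))
    refine ⟨g ^ n, Subgroup.zpow_mem _ (mem_torus_torusGen g) n, ?_⟩
    have := congrArg Subtype.val hn
    rw [map_zpow, hg]
    exact this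

theorem ne_inv_of_odd_card {K : Type} [Group K] (hK : Odd (Nat.card K)) {θ : K →* ℂˣ}
    (hθ : θ ≠ 1) : θ ≠ θ⁻¹ := by
  intro h
  apply hθ
  ext a
  have h1 : θ a ^ 2 = 1 := by
    have := DFunLike.congr_fun h a
    rw [MonoidHom.inv_apply, eq_inv_iff_mul_eq_one] at this
    rw [sq, this]
  have h2 : θ a ^ Nat.card K = 1 := by rw [← map_pow, pow_card_eq_one', map_one]
  have h3 := pow_gcd_eq_one.mpr ⟨h1, h2⟩
  rw [Nat.coprime_two_left.mpr hK, pow_one] at h3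
  simp [h3]

/-- Multiplicity of a nontrivial linear character of a nonsplit subgroup of odd prime order in an
irreducible character of degree `q + 1 - δ` of `PSL(2, q)`. -/
theorem exists_restMult_eq (hodd : Fintype.card F % 2 = 1) {p : ℕ} (hp : p.Prime) (hp2 : p ≠ 2)
    (hpq : p ∣ Fintype.card F + 1) (H : Subgroup (PSL2 F)) (hH : Nat.card H = p)
    {θ : H →* ℂˣ} (hθ : θ ≠ 1) (V : FDRep ℂ (PSL2 F)) [CategoryTheory.Simple V] {δ : ℕ}
    (hδ : δ ≤ 2) (hV : V.character 1 = (Fintype.card F : ℂ) + 1 - δ) :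
    ∃ e : ℕ, 2 * e ≤ δ ∧
      restMult H θ V.character = ((Fintype.card F : ℂ) + 1) / p - e := by
  have h2 : (2 : F) ≠ 0 := by
    apply Ring.two_ne_zero
    intro h
    have := FiniteField.even_card_iff_char_two.mp h
    omega
  obtain ⟨s, hs, hd, hHs⟩ := exists_le_map_torus h2 hp hp2 hpq H hH
  have hd0 : s.det ≠ 0 := by intro h; simp [h] at hd
  have hcomm : ∀ a b : (torus s).map (toPSL2 F), a * b = b * a := by
    rintro ⟨_, a, ha, rfl⟩ ⟨_, b, hb, rfl⟩
    apply Subtype.ext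
    simpa using congrArg (toPSL2 F) (torus_comm h2 hs hd0 ha hb)
  have hcard := card_eq_two_mul_card_map_toPSL2 h2 (center_le_torus s)
  rw [card_torus_of_not_isSquare h2 hs hd] at hcard
  obtain ⟨ι, _, ψ, h₁, h₂⟩ := exists_dual_system ((torus s).map (toPSL2 F)) hcomm
  obtain ⟨m, hm⟩ := exists_character_eq_sum V ((torus s).map (toPSL2 F)).subtype h₂
  obtain ⟨hsum, hsq⟩ := multiplicity_torus h2 V hs hd hδ hV h₁ h₂ hm
  have hnonneg : ∀ i, 0 ≤ (2 - m i : ℤ) := by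
    have hle : ∀ i ∈ Finset.univ, 0 ≤ (2 - m i : ℤ) ^ 2 - (2 - m i) := fun i _ =>
      sub_nonneg.mpr (Int.le_self_sq _)
    have hzero : ∑ i, ((2 - m i : ℤ) ^ 2 - (2 - m i)) = 0 := by
      apply le_antisymm _ (Finset.sum_nonneg hle)
      rw [Finset.sum_sub_distrib, hsum]
      linarith
    intro i
    have := (Finset.sum_eq_zero_iff_of_nonneg hle).mp hzero i (Finset.mem_univ i)
    nlinarith [sq_nonneg (2 - m i : ℤ)]
  let _ : Fintype H := Fintype.ofFinite H
  have hpos : (p : ℂ) ≠ 0 := by exact_mod_cast hp.ne_zero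
  let E (θ : H →* ℂˣ) : ℤ := ∑ i with (ψ i).comp (Subgroup.inclusion hHs) = θ, (2 - m i : ℤ)
  have hE (θ : H →* ℂˣ) : ∑ h : H, V.character h * (θ h : ℂ)⁻¹ =
      (Fintype.card F : ℂ) + 1 - p * E θ := by
    have := sum_restrict_mul_inv h₂ m 2 (Subgroup.inclusion_injective hHs) θ
    simp_rw [← hm] at this
    rw [← Nat.card_eq_fintype_card (α := H), hH] at this
    refine Eq.trans this ?_
    congr 1
    exact_mod_cast hcard.symm
  have hEinv : E θ⁻¹ = E θ := by
    have h : ∑ h : H, V.character h * (θ⁻¹ h : ℂ)⁻¹ = ∑ h : H, V.character h * (θ h : ℂ)⁻¹ := by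
      rw [← Equiv.sum_comp (Equiv.inv H)]
      refine Finset.sum_congr rfl fun h _ => ?_
      rw [Equiv.inv_apply, Subgroup.coe_inv,
        character_inv_of_mem_map_torus hodd h2 V hs hd (hHs h.2)]
      simp
    rw [hE, hE, sub_right_inj] at h
    exact_mod_cast mul_left_cancel₀ hpos h
  have hEnonneg : 0 ≤ E θ := Finset.sum_nonneg fun i _ => hnonneg i
  have hne := ne_inv_of_odd_card (by rw [hH]; exact hp.odd_of_ne_two hp2) hθ
  have hEle : E θ + E θ⁻¹ ≤ δ := by
    rw [← hsum, ← Finset.sum_union]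
    · exact Finset.sum_le_sum_of_subset_of_nonneg (Finset.subset_univ _) fun i _ _ => hnonneg i
    · exact Finset.disjoint_filter.mpr fun i _ h h' => hne (h.symm.trans h')
  obtain ⟨e, he⟩ := Int.eq_ofNat_of_zero_le hEnonneg
  refine ⟨e, by omega, ?_⟩
  have : restMult H θ V.character = (p : ℂ)⁻¹ * ∑ h : H, V.character h * (θ h : ℂ)⁻¹ := by
    rw [← hH]; rfl
  rw [this, hE, he]
  field_simp
  simp

end SL2

theorem induced_H7_multiplicities_q6mod7
    (q : ℕ) (hq : IsPrimePow q) (hgcd : Nat.Coprime q 42)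
    (hq7 : q % 7 = 1 ∨ q % 7 = 6)
    (F : Type) [Field F] [Fintype F] (hF : Fintype.card F = q)
    (H2 H3 H7 : Subgroup (PSL2 F))
    (hH2 : Nat.card H2 = 2) (hH3 : Nat.card H3 = 3) (hH7 : Nat.card H7 = 7)
    (θ2 : H2 →* ℂˣ) (θ3 : H3 →* ℂˣ) (θ7 : H7 →* ℂˣ)
    (hθ2 : Function.Injective θ2) (hθ3 : Function.Injective θ3)
    (hθ7 : Function.Injective θ7)
    (hq6 : q % 7 = 6) (k : ℕ) (hk : k ∈ Finset.Icc (1:ℕ) 6)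
    (χ : PSL2 F → ℂ) (hχ : IsIrrCharacter (PSL2 F) χ)
    :
    ((χ 1 = (q : ℂ) + 1 ∨ χ 1 = (q : ℂ)) →
      restMult H7 (θ7 ^ k) χ = ((q : ℂ) + 1) / 7) ∧
    (χ 1 = (q : ℂ) - 1 →
      restMult H7 (θ7 ^ k) χ = ((q : ℂ) + 1) / 7 ∨
      restMult H7 (θ7 ^ k) χ = ((q : ℂ) - 6) / 7) := by
  subst hF
  obtain ⟨V, _, rfl⟩ := hχ
  have hodd : Fintype.card F % 2 = 1 := by
    have : Nat.Coprime (Fintype.card F) 2 := hgcd.coprime_dvd_right (by norm_num)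
    exact Nat.odd_iff.mp (Nat.coprime_two_right.mp this)
  have hθ : θ7 ^ k ≠ 1 := by
    intro h
    have : Nontrivial H7 := by
      rw [← Finite.one_lt_card_iff_nontrivial, hH7]
      norm_num
    obtain ⟨y, hy⟩ := exists_ne (1 : H7)
    have hyk : y ^ k = 1 := by
      apply hθ7
      rw [map_pow, map_one, ← MonoidHom.pow_apply, h, MonoidHom.one_apply]
    have hy7 : y ^ 7 = 1 := by rw [← hH7]; exact pow_card_eq_one'
    apply hy
    have hcop : Nat.gcd k 7 = 1 := by
      rw [Finset.mem_Icc] at hk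
      obtain ⟨hk1, hk6⟩ := hk
      interval_cases k <;> rfl
    simpa [hcop] using pow_gcd_eq_one.mpr ⟨hyk, hy7⟩
  have key (δ : ℕ) (hδ : δ ≤ 2) (hV : V.character 1 = (Fintype.card F : ℂ) + 1 - δ) :=
    exists_restMult_eq hodd (p := 7) (by norm_num) (by norm_num) (by omega) H7 hH7 hθ V hδ hV
  refine ⟨?_, ?_⟩
  · rintro (h | h)
    · obtain ⟨e, he, hmult⟩ := key 0 (by norm_num) (by rw [h]; simp)
      obtain rfl : e = 0 := by omega
      simpa using hmult
    · obtain ⟨e, he, hmult⟩ := key 1 (by norm_num) (by rw [h]; simp)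
      obtain rfl : e = 0 := by omega
      simpa using hmult
  · intro h
    obtain ⟨e, he, hmult⟩ := key 2 le_rfl (by rw [h]; push_cast; ring)
    obtain rfl | rfl : e = 0 ∨ e = 1 := by omega
    · left; simpa using hmult
    · right
      rw [hmult]
      push_cast
      ring
end
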